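/- The geometric realization |Π_n| of the nerve of the poset of proper nontrivial partitions of {1,…,n} is homotopy equivalent (non-equivariantly) to a wedge of (n−1)! spheres of dimension n−3. -/

import Mathlib

open CategoryTheory

/-- The poset `Π_n` of proper nontrivial partitions of `{1,…,n}` (partitions of `Fin n`
as setoids, excluding the discrete partition `⊥` and the trivial one-block
partition `⊤`), ordered by refinement. -/
def PartitionPoset (n : ℕ) : Type :=
  {s : Setoid (Fin n) // s ≠ ⊥ ∧ s ≠ ⊤}

instance (n : ℕ) : PartialOrder (PartitionPoset n) :=
  inferInstanceAs (PartialOrder {s : Setoid (Fin n) // s ≠ ⊥ ∧ s ≠ ⊤})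

/-- The geometric realization `|Π_n|` of the nerve of the partition poset. -/
noncomputable def PartitionComplex (n : ℕ) : TopCat :=
  SSet.toTop.obj (nerve (PartitionPoset n))

/-- The wedge of `k` copies of the sphere `S^{d}` (the unit sphere in `ℝ^{d+1}`),
based at the point `e₀`. -/
noncomputable def WedgeOfSpheres (k d : ℕ) : Type :=
  Quot (fun a b : (Σ _ : Fin k, Metric.sphere (0 : EuclideanSpace ℝ (Fin (d + 1))) 1) ⊕ Unit =>
    a = b ∨
      ((match a with
        | .inl p => (p.2 : EuclideanSpace ℝ (Fin (d + 1))) = EuclideanSpace.single 0 1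
        | .inr _ => True) ∧
       (match b with
        | .inl p => (p.2 : EuclideanSpace ℝ (Fin (d + 1))) = EuclideanSpace.single 0 1
        | .inr _ => True)))

noncomputable instance (k d : ℕ) : TopologicalSpace (WedgeOfSpheres k d) :=
  inferInstanceAs (TopologicalSpace (Quot _))

namespace GeometricRealization
open Simplicial Opposite

/-- The characteristic map of a simplex in the geometric realization. -/
noncomputable def charMap {X : SSet.{0}} {n : SimplexCategory} (x : X.obj (op n))
    (t : stdSimplex ℝ (Fin (n.len + 1))) : SSet.toTop.obj X :=
  SSet.toTop.map (SSet.yonedaEquiv.symm x) (n.toTopHomeo.symm t)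

lemma continuous_charMap {X : SSet.{0}} {n : SimplexCategory} (x : X.obj (op n)) :
    Continuous (charMap x) := by
  unfold charMap
  fun_prop

lemma charMap_map {X : SSet.{0}} {n m : SimplexCategory} (f : n ⟶ m) (x : X.obj (op m))
    (t : stdSimplex ℝ (Fin (n.len + 1))) :
    charMap (X.map f.op x) t = charMap x (stdSimplex.map f t) := by
  unfold charMap
  rw [← SSet.yonedaEquiv_symm_naturality_left, SimplexCategory.toTopHomeo_symm_naturality_apply,
    Functor.map_comp]
  rfl

lemma app_unit_charMap {X : SSet.{0}} {Y : TopCat.{0}} (f : SSet.toTop.obj X ⟶ Y)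
    {n : SimplexCategory} (x : X.obj (op n)) (t : stdSimplex ℝ (Fin (n.len + 1))) :
    TopCat.toSSetObjEquiv Y _ ((sSetTopAdj.homEquiv _ _ f).app (op n) x) t = f (charMap x t) := by
  rw [Adjunction.homEquiv_unit]
  have := sSetTopAdj_unit_app_app_down X (op n) x
  let u : SimplexCategory.toTop.{0}.obj n ⟶ SSet.toTop.obj X :=
    ((sSetTopAdj.unit.app X).app (op n) x).down
  change f (u (ULift.up t)) = _
  have : u = _ := this
  rw [this]
  rfl

lemma toTop_hom_ext {X : SSet.{0}} {Y : TopCat.{0}} {f g : SSet.toTop.obj X ⟶ Y}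
    (h : ∀ (n : SimplexCategory) (x : X.obj (op n)) t, f (charMap x t) = g (charMap x t)) :
    f = g := by
  apply (sSetTopAdj.homEquiv _ _).injective
  ext ⟨n⟩ x
  apply (TopCat.toSSetObjEquiv Y _).injective
  ext t
  exact (app_unit_charMap f x t).trans ((h n x t).trans (app_unit_charMap g x t).symm)

lemma homEquiv_symm_charMap {X : SSet.{0}} {Y : TopCat.{0}} (g : X ⟶ TopCat.toSSet.obj Y)
    {n : SimplexCategory} (x : X.obj (op n)) (t : stdSimplex ℝ (Fin (n.len + 1))) :
    (sSetTopAdj.homEquiv _ _).symm g (charMap x t) =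
      TopCat.toSSetObjEquiv Y _ (g.app (op n) x) t := by
  rw [← app_unit_charMap, Equiv.apply_symm_apply]

lemma exists_charMap {X : SSet.{0}} (p : SSet.toTop.obj X) :
    ∃ (n : SimplexCategory) (x : X.obj (op n)) (t : _), charMap x t = p := by
  by_contra hp
  let _ : TopologicalSpace Prop := ⊤
  let f : SSet.toTop.obj X ⟶ TopCat.of Prop := TopCat.ofHom
    ⟨fun q ↦ ∃ (n : SimplexCategory) (x : X.obj (op n)) (t : _), charMap x t = q, continuous_top⟩
  let g : SSet.toTop.obj X ⟶ TopCat.of Prop := TopCat.ofHom ⟨fun q ↦ True, continuous_top⟩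
  have hfg : f = g := toTop_hom_ext fun n x t ↦ eq_true ⟨n, x, t, rfl⟩
  exact hp (of_eq_true (ConcreteCategory.congr_hom hfg p))

end GeometricRealization

/-- The geometric realization, inside `V → ℝ`, of a family of faces on a vertex set `V`. -/
def geomReal {V : Type} [Fintype V] (K : Set (Set V)) : Set (V → ℝ) :=
  {w | w ∈ stdSimplex ℝ V ∧ Function.support w ∈ K}

/-- The chains of a poset. -/
def chainFaces (P : Type) [LE P] : Set (Set P) := {c | IsChain (· ≤ ·) c}

namespace GeometricRealization
open Simplicial Opposite

variable {P : Type} [PartialOrder P]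

open Classical in
lemma stdSimplex_map_apply {V W : Type} [Fintype V] [Fintype W] (f : V → W)
    (t : stdSimplex ℝ V) (p : W) : stdSimplex.map f t p = ∑ i with f i = p, t i := by
  rw [stdSimplex.map_coe, FunOnFinite.linearMap_apply_apply]

lemma le_stdSimplex_map {V W : Type} [Fintype V] [Fintype W] (f : V → W)
    (t : stdSimplex ℝ V) (i : V) : t i ≤ stdSimplex.map f t (f i) := by
  classical
  rw [stdSimplex_map_apply]
  exact Finset.single_le_sum (fun j _ ↦ t.2.1 j) (by simp)

lemma stdSimplex_map_apply_of_injective {V W : Type} [Fintype V] [Fintype W] {f : V → W}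
    (hf : f.Injective) (t : stdSimplex ℝ V) (i : V) : stdSimplex.map f t (f i) = t i := by
  classical
  rw [stdSimplex_map_apply]
  simp only [hf.eq_iff]
  exact Finset.sum_eq_single_of_mem i (by simp) (by simp +contextual)

lemma support_stdSimplex_map_subset {V W : Type} [Fintype V] [Fintype W] (f : V → W)
    (t : stdSimplex ℝ V) : Function.support (stdSimplex.map f t) ⊆ Set.range f := by
  classical
  intro p hp
  by_contra hpr
  apply hp
  rw [stdSimplex_map_apply]
  apply Finset.sum_eq_zero
  intro i hi
  exact absurd ⟨i, by simpa using hi⟩ hpr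

/-- A point of a standard simplex supported on the range of an injective map is in the image of
the induced map. -/
lemma exists_stdSimplex_map_eq {V W : Type} [Fintype V] [Fintype W] {f : V → W}
    (hf : f.Injective) (t : stdSimplex ℝ W) (ht : Function.support t ⊆ Set.range f) :
    ∃ s, stdSimplex.map f s = t := by
  classical
  have hsum : ∑ i, t (f i) = 1 := by
    rw [← t.2.2]
    apply Finset.sum_of_injOn f hf.injOn (by simp) _ (by simp; intros; rfl)
    intro p _ hp
    by_contra h
    exact hp (by simpa using ht h)
  refine ⟨⟨fun i ↦ t (f i), fun i ↦ t.2.1 _, hsum⟩, ?_⟩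
  ext p
  by_cases hp : p ∈ Set.range f
  · obtain ⟨i, rfl⟩ := hp
    rw [stdSimplex_map_apply_of_injective hf]
    rfl
  · rw [Function.notMem_support.1 fun h ↦ hp (support_stdSimplex_map_subset _ _ h),
      Function.notMem_support.1 fun h ↦ hp (ht h)]

lemma isChain_support_map [Fintype P] {m : ℕ} {f : Fin (m + 1) → P} (hf : Monotone f)
    (t : stdSimplex ℝ (Fin (m + 1))) :
    IsChain (· ≤ ·) (Function.support (stdSimplex.map f t)) := by
  refine IsChain.mono (support_stdSimplex_map_subset f t) ?_
  rintro _ ⟨i, rfl⟩ _ ⟨j, rfl⟩ _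
  exact (le_total i j).imp (fun h ↦ hf h) (fun h ↦ hf h)

/-- The simplicial map from the nerve of a finite poset to the singular simplicial set
of the realization of its chains. -/
noncomputable def nerveToSing (P : Type) [PartialOrder P] [Fintype P] :
    nerve P ⟶ TopCat.toSSet.obj (TopCat.of (geomReal (chainFaces P))) where
  app n := TypeCat.ofHom fun x ↦ (TopCat.toSSetObjEquiv _ n).symm
    ⟨fun t ↦ ⟨stdSimplex.map x.obj t, (stdSimplex.map x.obj t).2,
      isChain_support_map x.monotone t⟩, by
        have := stdSimplex.continuous_map (S := ℝ) x.obj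
        fun_prop⟩
  naturality n m f := by
    ext x
    apply (TopCat.toSSetObjEquiv _ _).injective
    ext t : 2
    have h := congrArg (fun z : stdSimplex ℝ P ↦ (z : P → ℝ))
      (stdSimplex.map_comp_apply f.unop x.obj t)
    exact h.symm

/-- The comparison map from the realization of the nerve of a finite poset to the
realization of its chains. -/
noncomputable def comparison (P : Type) [PartialOrder P] [Fintype P] :
    SSet.toTop.obj (nerve P) ⟶ TopCat.of (geomReal (chainFaces P)) :=
  (sSetTopAdj.homEquiv _ _).symm (nerveToSing P)

lemma comparison_charMap [Fintype P] {n : SimplexCategory} (x : (nerve P).obj (op n))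
    (t : stdSimplex ℝ (Fin (n.len + 1))) :
    (comparison P (charMap x t) : geomReal (chainFaces P)).1 = stdSimplex.map x.obj t := by
  unfold comparison
  rw [homEquiv_symm_charMap]
  rfl

lemma exists_enumeration [Fintype P] {C : Set P} (hC : IsChain (· ≤ ·) C) (hne : C.Nonempty) :
    ∃ (n : SimplexCategory) (x : (nerve P).obj (op n)),
      StrictMono x.obj ∧ Set.range x.obj = C := by
  classical
  let _ : LinearOrder C := 
    { (inferInstance : PartialOrder C) with
      le_total := fun a b ↦ hC.total a.2 b.2
      toDecidableLE := Classical.decRel _ }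
  have : Nonempty C := hne.to_subtype
  obtain ⟨m, hm⟩ := Nat.exists_eq_succ_of_ne_zero (Fintype.card_ne_zero (α := C))
  let e : Fin (m + 1) ≃o C := Fintype.orderIsoFinOfCardEq C hm
  have he : StrictMono fun i ↦ (e i : P) := fun i j h ↦ e.strictMono h
  refine ⟨.mk m, he.monotone.functor, he, ?_⟩
  ext p
  constructor
  · rintro ⟨i, rfl⟩
    exact (e i).2
  · intro hp
    exact ⟨e.symm ⟨p, hp⟩, congrArg Subtype.val (e.apply_symm_apply _)⟩

lemma support_nonempty {V : Type} [Fintype V] {w : V → ℝ} (hw : w ∈ stdSimplex ℝ V) :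
    (Function.support w).Nonempty := by
  by_contra h
  have h0 : w = 0 := by simpa [Set.not_nonempty_iff_eq_empty] using h
  simpa [h0] using hw.2

lemma charMap_eq_charMap_of_range_eq [Fintype P] {n m : SimplexCategory}
    (x : (nerve P).obj (op n)) (t : stdSimplex ℝ (Fin (n.len + 1)))
    (E : (nerve P).obj (op m)) (hE : StrictMono E.obj)
    (hr : Set.range E.obj = Function.support (stdSimplex.map x.obj t)) :
    ∃ s, charMap x t = charMap E s := by
  classical
  let S : Set (Fin (n.len + 1)) := Function.support t
  have hS : S.Nonempty := support_nonempty t.2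
  obtain ⟨k, δ, hδ, hδr⟩ := exists_enumeration (P := Fin (n.len + 1)) (C := S)
    (fun a _ b _ _ ↦ le_total a b) hS
  let d : k ⟶ n := SimplexCategory.Hom.mk ⟨δ.obj, δ.monotone⟩
  obtain ⟨t', rfl⟩ := exists_stdSimplex_map_eq hδ.injective t hδr.ge
  have hmem : ∀ i, ∃ j, E.obj j = x.obj (δ.obj i) := by
    intro i
    change _ ∈ Set.range E.obj
    rw [hr]
    have : δ.obj i ∈ S := hδr ▸ ⟨i, rfl⟩
    exact ne_of_gt (lt_of_lt_of_le (lt_of_le_of_ne (stdSimplex.zero_le _ _) (Ne.symm this))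
      (le_stdSimplex_map x.obj _ _))
  choose σ hσ using hmem
  have hσm : Monotone σ := fun i j h ↦ by
    rw [← hE.le_iff_le, hσ, hσ]
    exact x.monotone (δ.monotone h)
  let u : k ⟶ m := SimplexCategory.Hom.mk ⟨σ, hσm⟩
  refine ⟨stdSimplex.map σ t', ?_⟩
  have h1 := charMap_map d x t'
  have h2 := charMap_map u E t'
  refine h1.symm.trans (Eq.trans ?_ h2)
  congr 1
  exact nerve.ext_of_isThin (funext fun i ↦ (hσ i).symm)

lemma comparison_bijective [Fintype P] : Function.Bijective (comparison P) := by
  constructor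
  · intro p q hpq
    obtain ⟨n, x, t, rfl⟩ := exists_charMap p
    obtain ⟨m, y, s, rfl⟩ := exists_charMap q
    have h : (stdSimplex.map x.obj t : P → ℝ) = stdSimplex.map y.obj s := by
      have := congrArg (fun z : geomReal (chainFaces P) ↦ z.1) hpq
      exact (comparison_charMap _ _).symm.trans (this.trans (comparison_charMap _ _))
    obtain ⟨k, E, hE, hEr⟩ := exists_enumeration (isChain_support_map x.monotone t)
      (support_nonempty (stdSimplex.map x.obj t).2)
    obtain ⟨a, ha⟩ := charMap_eq_charMap_of_range_eq x t E hE hEr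
    obtain ⟨b, hb⟩ := charMap_eq_charMap_of_range_eq y s E hE (hEr.trans (by rw [h]))
    rw [ha, hb] at hpq ⊢
    have h' : (stdSimplex.map E.obj a : P → ℝ) = stdSimplex.map E.obj b := by
      have := congrArg (fun z : geomReal (chainFaces P) ↦ z.1) hpq
      exact (comparison_charMap _ _).symm.trans (this.trans (comparison_charMap _ _))
    congr 1
    ext i
    rw [← stdSimplex_map_apply_of_injective hE.injective a, h',
      stdSimplex_map_apply_of_injective hE.injective]
  · rintro ⟨w, hw, hc⟩
    obtain ⟨k, E, hE, hEr⟩ := exists_enumeration hc (support_nonempty hw)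
    obtain ⟨s, hs⟩ := exists_stdSimplex_map_eq hE.injective ⟨w, hw⟩ hEr.ge
    refine ⟨charMap E s, Subtype.ext ?_⟩
    rw [comparison_charMap, hs]
    rfl

lemma compactSpace_realization_nerve [Finite P] : CompactSpace (SSet.toTop.obj (nerve P)) := by
  classical
  have := Fintype.ofFinite P
  choose n E hE hEr using fun C : {C : Set P // IsChain (· ≤ ·) C ∧ C.Nonempty} ↦
    exists_enumeration C.2.1 C.2.2
  constructor
  have : (Set.univ : Set (SSet.toTop.obj (nerve P))) = ⋃ C, Set.range (charMap (E C)) := by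
    symm
    rw [Set.eq_univ_iff_forall]
    intro p
    obtain ⟨m, x, t, rfl⟩ := exists_charMap p
    let C : {C : Set P // IsChain (· ≤ ·) C ∧ C.Nonempty} :=
      ⟨_, isChain_support_map x.monotone t, support_nonempty (stdSimplex.map x.obj t).2⟩
    obtain ⟨s, hs⟩ := charMap_eq_charMap_of_range_eq x t (E C) (hE C) (hEr C)
    exact Set.mem_iUnion.2 ⟨C, s, hs.symm⟩
  rw [this]
  exact isCompact_iUnion fun C ↦ isCompact_range (continuous_charMap _)

/-- The realization of the nerve of a finite poset is the realization of its chains. -/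
noncomputable def nerveHomeo (P : Type) [PartialOrder P] [Fintype P] :
    SSet.toTop.obj (nerve P) ≃ₜ geomReal (chainFaces P) :=
  have := compactSpace_realization_nerve (P := P)
  Continuous.homeoOfEquivCompactToT2 (f := Equiv.ofBijective _ comparison_bijective)
    (comparison P).hom.continuous

end GeometricRealization

/-- A subset `S` of a topological space is an absolute extensor for metric spaces. -/
def IsAbsExtensor {E : Type} [TopologicalSpace E] (S : Set E) : Prop :=
  ∀ (Z : Type) [MetricSpace Z] (A : Set Z), IsClosed A → ∀ f : Z → E, ContinuousOn f A →
    Set.MapsTo f A S → ∃ g : Z → E, Continuous g ∧ (∀ z, g z ∈ S) ∧ Set.EqOn g f A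

namespace IsAbsExtensor
open Set

variable {E E' : Type} [TopologicalSpace E] [TopologicalSpace E']

lemma nonempty [Nonempty E] {S : Set E} (h : IsAbsExtensor S) : S.Nonempty := by
  obtain ⟨g, -, hg, -⟩ := h Unit ∅ isClosed_empty (fun _ ↦ Classical.arbitrary E)
    continuousOn_const (mapsTo_empty _ _)
  exact ⟨_, hg ()⟩

lemma image {S : Set E} (h : IsAbsExtensor S) {i : E → E'} {j : E' → E} (hi : Continuous i)
    (hj : Continuous j) (hij : LeftInvOn j i S) : IsAbsExtensor (i '' S) := by
  intro Z _ A hA f hf hfS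
  obtain ⟨g, hg, hgS, hgf⟩ := h Z A hA (j ∘ f) (hj.comp_continuousOn hf) (fun z hz ↦ by
    obtain ⟨x, hx, hxz⟩ := hfS hz
    simpa [← hxz, hij hx] using hx)
  refine ⟨i ∘ g, hi.comp hg, fun z ↦ mem_image_of_mem i (hgS z), fun z hz ↦ ?_⟩
  obtain ⟨x, hx, hxz⟩ := hfS hz
  simp [hgf hz, ← hxz, hij hx]

lemma prod {S : Set E} {T : Set E'} (hS : IsAbsExtensor S) (hT : IsAbsExtensor T) :
    IsAbsExtensor (S ×ˢ T) := by
  intro Z _ A hA f hf hfS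
  obtain ⟨g, hg, hgS, hgf⟩ := hS Z A hA (fun z ↦ (f z).1) hf.fst fun z hz ↦ (hfS hz).1
  obtain ⟨k, hk, hkT, hkf⟩ := hT Z A hA (fun z ↦ (f z).2) hf.snd fun z hz ↦ (hfS hz).2
  exact ⟨fun z ↦ (g z, k z), hg.prodMk hk, fun z ↦ ⟨hgS z, hkT z⟩,
    fun z hz ↦ Prod.ext (hgf hz) (hkf hz)⟩

lemma of_retraction [TietzeExtension.{0} E] {S : Set E} {r : E → E} (hr : Continuous r)
    (hrS : ∀ x, r x ∈ S) (hid : ∀ x ∈ S, r x = x) : IsAbsExtensor S := by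
  intro Z _ A hA f hf hfS
  obtain ⟨g, hg⟩ := ContinuousMap.exists_restrict_eq hA ⟨A.domRestrict f, hf.domRestrict⟩
  refine ⟨r ∘ g, hr.comp g.continuous, fun z ↦ hrS _, fun z hz ↦ ?_⟩
  have : g z = f z := congrArg (fun k : C(A, E) ↦ k ⟨z, hz⟩) hg
  simp [this, hid _ (hfS hz)]

lemma union {S T : Set E} (hS : IsAbsExtensor S) (hT : IsAbsExtensor T)
    (hST : IsAbsExtensor (S ∩ T)) (hSc : IsClosed S) (hTc : IsClosed T) :
    IsAbsExtensor (S ∪ T) := by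
  classical
  intro Z _ A hA f hf hfS
  have hA₁ := hf.preimage_isClosed_of_isClosed hA hSc
  have hA₂ := hf.preimage_isClosed_of_isClosed hA hTc
  set A₁ := A ∩ f ⁻¹' S
  set A₂ := A ∩ f ⁻¹' T
  let Z₁ : Set Z := {z | Metric.infEDist z A₁ ≤ Metric.infEDist z A₂}
  let Z₂ : Set Z := {z | Metric.infEDist z A₂ ≤ Metric.infEDist z A₁}
  have hZ₁ : IsClosed Z₁ := isClosed_le Metric.continuous_infEDist Metric.continuous_infEDist
  have hZ₂ : IsClosed Z₂ := isClosed_le Metric.continuous_infEDist Metric.continuous_infEDist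
  have hAZ₁ : A ∩ Z₁ = A₁ := by
    ext z
    refine ⟨fun ⟨hz, hz₁⟩ ↦ ?_, fun hz ↦ ⟨hz.1, ?_⟩⟩
    · rcases hfS hz with h | h
      · exact ⟨hz, h⟩
      · have h0 : Metric.infEDist z A₂ = 0 := Metric.infEDist_zero_of_mem ⟨hz, h⟩
        rw [← hA₁.closure_eq, Metric.mem_closure_iff_infEDist_zero]
        exact le_antisymm (h0 ▸ hz₁) bot_le
    · simp [Z₁, Metric.infEDist_zero_of_mem hz]
  have hAZ₂ : A ∩ Z₂ = A₂ := by
    ext z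
    refine ⟨fun ⟨hz, hz₁⟩ ↦ ?_, fun hz ↦ ⟨hz.1, ?_⟩⟩
    · rcases hfS hz with h | h
      · have h0 : Metric.infEDist z A₁ = 0 := Metric.infEDist_zero_of_mem ⟨hz, h⟩
        rw [← hA₂.closure_eq, Metric.mem_closure_iff_infEDist_zero]
        exact le_antisymm (h0 ▸ hz₁) bot_le
      · exact ⟨hz, h⟩
    · simp [Z₂, Metric.infEDist_zero_of_mem hz]
  obtain ⟨g₀, hg₀, hg₀S, hg₀f⟩ := hST Z (A₁ ∩ A₂) (hA₁.inter hA₂) f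
    (hf.mono fun z hz ↦ hz.1.1) fun z hz ↦ ⟨hz.1.2, hz.2.2⟩
  have key : ∀ (R : Set E) (B : Set Z), IsAbsExtensor R → S ∩ T ⊆ R → IsClosed B → B ⊆ A →
      MapsTo f B R → B ∩ (Z₁ ∩ Z₂) ⊆ A₁ ∩ A₂ → 
      ∃ g : Z → E, Continuous g ∧ (∀ z, g z ∈ R) ∧ EqOn g f B ∧ EqOn g g₀ (Z₁ ∩ Z₂) := by
    intro R B hR hRS hB hBA hfB hBZ
    let k : Z → E := B.piecewise f g₀
    have hk : EqOn k f B := piecewise_eqOn _ _ _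
    have hk₀ : EqOn k g₀ (Z₁ ∩ Z₂) := fun z hz ↦ by
      by_cases hzB : z ∈ B
      · rw [hk hzB, hg₀f (hBZ ⟨hzB, hz⟩)]
      · exact piecewise_eq_of_notMem _ _ _ hzB
    have hkc : ContinuousOn k (B ∪ Z₁ ∩ Z₂) :=
      ((hf.mono hBA).congr hk).union_of_isClosed (hg₀.continuousOn.congr hk₀) hB (hZ₁.inter hZ₂)
    obtain ⟨g, hg, hgR, hgk⟩ := hR Z _ (hB.union (hZ₁.inter hZ₂)) k hkc (by
      rintro z (hz | hz)
      · rw [hk hz]; exact hfB hz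
      · rw [hk₀ hz]; exact hRS (hg₀S z))
    exact ⟨g, hg, hgR, (hgk.mono subset_union_left).trans hk,
      (hgk.mono subset_union_right).trans hk₀⟩
  have hsub : A ∩ (Z₁ ∩ Z₂) ⊆ A₁ ∩ A₂ := by
    rw [← hAZ₁, ← hAZ₂]
    exact fun z hz ↦ ⟨⟨hz.1, hz.2.1⟩, ⟨hz.1, hz.2.2⟩⟩
  obtain ⟨g₁, hg₁, hg₁S, hg₁f, hg₁₀⟩ := key S A₁ hS inter_subset_left hA₁ inter_subset_left
    (fun z hz ↦ hz.2) fun z hz ↦ hsub ⟨hz.1.1, hz.2⟩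
  obtain ⟨g₂, hg₂, hg₂S, hg₂f, hg₂₀⟩ := key T A₂ hT inter_subset_right hA₂ inter_subset_left
    (fun z hz ↦ hz.2) fun z hz ↦ hsub ⟨hz.1.1, hz.2⟩
  have hZ : Z₁ ∪ Z₂ = univ := eq_univ_of_forall fun z ↦
    le_total (Metric.infEDist z A₁) (Metric.infEDist z A₂)
  have hgZ₁ : EqOn (Z₁.piecewise g₁ g₂) g₁ Z₁ := piecewise_eqOn _ _ _
  have hgZ₂ : EqOn (Z₁.piecewise g₁ g₂) g₂ Z₂ := fun z hz ↦ by
    by_cases hz₁ : z ∈ Z₁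
    · rw [hgZ₁ hz₁, hg₁₀ ⟨hz₁, hz⟩, hg₂₀ ⟨hz₁, hz⟩]
    · exact piecewise_eq_of_notMem _ _ _ hz₁
  refine ⟨Z₁.piecewise g₁ g₂, ?_, fun z ↦ ?_, fun z hz ↦ ?_⟩
  · rw [← continuousOn_univ, ← hZ]
    exact (hg₁.continuousOn.congr hgZ₁).union_of_isClosed (hg₂.continuousOn.congr hgZ₂) hZ₁ hZ₂
  · by_cases hz : z ∈ Z₁
    · rw [hgZ₁ hz]; exact Or.inl (hg₁S z)
    · rw [piecewise_eq_of_notMem _ _ _ hz]; exact Or.inr (hg₂S z)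
  · rcases (hZ.ge (mem_univ z)) with h | h
    · rw [hgZ₁ h, hg₁f (hAZ₁.le ⟨hz, h⟩)]
    · rw [hgZ₂ h, hg₂f (hAZ₂.le ⟨hz, h⟩)]

/-- A finite union of sets, all retracted into a common member `C` by the same map, is an absolute
extensor when the sets come from a class of absolute extensors stable under intersection. -/
lemma biUnion {Good : Set E → Prop} (hinter : ∀ S T, Good S → Good T → Good (S ∩ T))
    (hclosed : ∀ S, Good S → IsClosed S) (hae : ∀ S, Good S → S.Nonempty → IsAbsExtensor S)
    (π : E → E) {ι : Type} (J : Finset ι) (C : Set E) (D : ι → Set E) (hC : Good C)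
    (hCne : C.Nonempty) (hD : ∀ j ∈ J, Good (D j)) (hπ : ∀ j ∈ J, MapsTo π (D j) (D j ∩ C)) :
    IsAbsExtensor (C ∪ ⋃ j ∈ J, D j) := by
  classical
  induction J using Finset.induction_on generalizing C D with
  | empty => simpa using hae C hC hCne
  | insert i J hi ih =>
    have hJ : IsAbsExtensor (C ∪ ⋃ j ∈ J, D j) :=
      ih C D hC hCne (fun j hj ↦ hD j (by simp [hj])) (fun j hj ↦ hπ j (by simp [hj]))
    have hDi := hD i (by simp)
    have heq : C ∪ ⋃ j ∈ insert i J, D j = (C ∪ ⋃ j ∈ J, D j) ∪ D i := by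
      rw [Finset.set_biUnion_insert, union_comm (D i), union_assoc]
    rw [heq]
    rcases (D i).eq_empty_or_nonempty with h0 | ⟨x, hx⟩
    · simpa [h0] using hJ
    have hinter' : (C ∪ ⋃ j ∈ J, D j) ∩ D i = (C ∩ D i) ∪ ⋃ j ∈ J, (D j ∩ D i) := by
      rw [union_inter_distrib_right, iUnion₂_inter]
    refine hJ.union (hae _ hDi ⟨x, hx⟩) ?_ ?_ (hclosed _ hDi)
    · rw [hinter']
      refine ih _ _ (hinter _ _ hC hDi) ⟨π x, ?_⟩
        (fun j hj ↦ hinter _ _ (hD j (by simp [hj])) hDi) fun j hj y hy ↦ ?_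
      · exact (hπ i (by simp) hx).symm
      · have h1 := hπ i (by simp) hy.2
        exact ⟨⟨(hπ j (by simp [hj]) hy.1).1, h1.1⟩, h1.2, h1.1⟩
    · exact (hclosed _ hC).union
        (J.finite_toSet.isClosed_biUnion fun j hj ↦
          hclosed _ (hD j (by simp [Finset.mem_coe.1 hj])))

lemma Icc : IsAbsExtensor (Icc (0 : ℝ) 1) :=
  of_retraction (r := fun x ↦ max 0 (min x 1)) (by fun_prop)
    (fun x ↦ ⟨le_max_left _ _, max_le zero_le_one (min_le_right _ _)⟩)
    fun x hx ↦ by rw [min_eq_left hx.2, max_eq_right hx.1]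

lemma singleton (x : E) : IsAbsExtensor {x} := fun _ _ _ _ _ _ hfS ↦
  ⟨fun _ ↦ x, continuous_const, fun _ ↦ rfl, fun _ hz ↦ (hfS hz).symm⟩

end IsAbsExtensor

section Faces
open Set

variable {V : Type} [Fintype V]

/-- The closed face of the standard simplex on `V` spanned by `σ`. -/
def face (σ : Set V) : Set (V → ℝ) := {w | w ∈ stdSimplex ℝ V ∧ Function.support w ⊆ σ}

lemma isClosed_face (σ : Set V) : IsClosed (face σ) := by
  have : face σ = stdSimplex ℝ V ∩ ⋂ v ∈ σᶜ, {w | w v = 0} := by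
    ext w
    simp only [face, mem_ofPred_eq, mem_inter_iff, mem_iInter, mem_compl_iff]
    refine and_congr_right fun _ ↦ ⟨fun h v hv ↦ ?_, fun h v hv ↦ ?_⟩
    · by_contra h0; exact hv (h h0)
    · by_contra h0; exact hv (h v h0)
  rw [this]
  exact (isClosed_stdSimplex ℝ V).inter (isClosed_biInter fun v _ ↦
    isClosed_eq (continuous_apply v) continuous_const)

lemma face_inter (σ τ : Set V) : face σ ∩ face τ = face (σ ∩ τ) := by
  ext w
  simp only [face, mem_inter_iff, mem_ofPred_eq, subset_inter_iff]
  tauto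

lemma face_mono {σ τ : Set V} (h : σ ⊆ τ) : face σ ⊆ face τ := fun _ hw ↦ ⟨hw.1, hw.2.trans h⟩

lemma nonempty_of_face_nonempty {σ : Set V} (h : (face σ).Nonempty) : σ.Nonempty := by
  obtain ⟨w, hw⟩ := h
  exact (GeometricRealization.support_nonempty hw.1).mono hw.2

lemma single_mem_face [DecidableEq V] {σ : Set V} {v : V} (hv : v ∈ σ) :
    Pi.single v 1 ∈ face σ := by
  refine ⟨single_mem_stdSimplex ℝ v, fun u hu ↦ ?_⟩
  by_contra h
  exact hu (Pi.single_eq_of_ne (fun huv : u = v ↦ h (by rwa [huv])) _)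

lemma geomReal_eq_biUnion {K : Set (Set V)} (hK : IsLowerSet K) :
    geomReal K = ⋃ σ ∈ K, face σ := by
  ext w
  simp only [geomReal, face, mem_ofPred_eq, mem_iUnion, exists_prop]
  exact ⟨fun h ↦ ⟨_, h.2, h.1, Subset.rfl⟩, fun ⟨σ, hσ, h1, h2⟩ ↦ ⟨h1, hK h2 hσ⟩⟩

lemma isClosed_geomReal {K : Set (Set V)} (hK : IsLowerSet K) : IsClosed (geomReal K) := by
  rw [geomReal_eq_biUnion hK]
  exact (toFinite K).isClosed_biUnion fun σ _ ↦ isClosed_face σ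

lemma geomReal_union (K L : Set (Set V)) : geomReal (K ∪ L) = geomReal K ∪ geomReal L := by
  ext w
  simp only [geomReal, mem_ofPred_eq, mem_union]
  tauto

lemma geomReal_inter (K L : Set (Set V)) : geomReal (K ∩ L) = geomReal K ∩ geomReal L := by
  ext w
  simp only [geomReal, mem_ofPred_eq, mem_inter_iff]
  tauto

lemma IsAbsExtensor.face {σ : Set V} (hσ : σ.Nonempty) : IsAbsExtensor (face σ) := by
  classical
  obtain ⟨v, hv⟩ := hσ
  let S : (V → ℝ) → ℝ := fun w ↦ ∑ p, if p ∈ σ then max (w p) 0 else 0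
  have hS : Continuous S := continuous_finsetSum _ fun p _ ↦ by split_ifs <;> fun_prop
  have h1 : ∀ w, max (S w) 1 ≠ 0 := fun w ↦ (lt_of_lt_of_le one_pos (le_max_right _ _)).ne'
  refine of_retraction (r := fun w p ↦ ((if p ∈ σ then max (w p) 0 else 0) +
    (if p = v then max 0 (1 - S w) else 0)) / max (S w) 1) ?_ (fun w ↦ ⟨⟨fun p ↦ ?_, ?_⟩, ?_⟩) ?_
  · refine continuous_pi fun p ↦ Continuous.div ?_ (by fun_prop) h1
    split_ifs <;> fun_prop
  · have : 0 ≤ max (S w) 1 := zero_le_one.trans (le_max_right _ _)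
    dsimp only; split_ifs <;> positivity
  · rw [← Finset.sum_div, Finset.sum_add_distrib, div_eq_one_iff_eq (h1 w)]
    simp only [Finset.sum_ite_eq', Finset.mem_univ, if_true]
    change S w + _ = _
    rcases le_total (S w) 1 with h | h
    · rw [max_eq_right (by linarith : (0:ℝ) ≤ 1 - S w), max_eq_right h]; ring
    · rw [max_eq_left (by linarith : 1 - S w ≤ (0:ℝ)), max_eq_left h]; ring
  · intro p hp
    by_contra h
    refine hp ?_
    have : p ≠ v := fun h' ↦ h (h' ▸ hv)
    simp [h, this]
  · intro w hw
    have hz : ∀ p, (if p ∈ σ then max (w p) 0 else 0) = w p := fun p ↦ by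
      split_ifs with h
      · exact max_eq_left (hw.1.1 p)
      · by_contra h'; exact h (hw.2 fun h0 ↦ h' h0.symm)
    have hS1 : S w = 1 := by simp only [S, hz]; exact hw.1.2
    funext p
    simp [hz, hS1]

/-- A simplicial complex that is a cone is an absolute extensor. -/
lemma IsAbsExtensor.geomReal_of_cone {K : Set (Set V)} (hK : IsLowerSet K) {y : V}
    (hy : {y} ∈ K) (h : ∀ σ ∈ K, insert y σ ∈ K) : IsAbsExtensor (geomReal K) := by
  classical
  have hmem {σ : Set V} (hσ : y ∈ σ) : Pi.single y 1 ∈ _root_.face σ := single_mem_face hσ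
  have key := biUnion (Good := fun S ↦ ∃ σ : Set V, S = _root_.face σ) (E := V → ℝ)
    (by rintro _ _ ⟨σ, rfl⟩ ⟨τ, rfl⟩; exact ⟨_, face_inter σ τ⟩)
    (by rintro _ ⟨σ, rfl⟩; exact isClosed_face σ)
    (by rintro _ ⟨σ, rfl⟩ hne; exact face (nonempty_of_face_nonempty hne))
    (fun _ ↦ Pi.single y 1) (toFinite K).toFinset
    (_root_.face {y}) (fun σ ↦ _root_.face (insert y σ))
    ⟨_, rfl⟩ ⟨_, hmem rfl⟩ (fun σ _ ↦ ⟨_, rfl⟩)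
    (fun σ _ w _ ↦ ⟨hmem (mem_insert _ _), hmem rfl⟩)
  convert key using 1
  rw [geomReal_eq_biUnion hK]
  refine subset_antisymm (iUnion₂_subset fun σ hσ ↦ ?_)
    (union_subset (subset_biUnion_of_mem hy) (iUnion₂_subset fun σ hσ ↦ ?_))
  · refine subset_union_of_subset_right ?_ _
    exact (face_mono (subset_insert y σ)).trans
      (subset_biUnion_of_mem (u := fun σ ↦ _root_.face (insert y σ)) (by simpa using hσ))
  · exact subset_biUnion_of_mem (u := fun σ ↦ _root_.face σ) (h σ (by simpa using hσ))

end Faces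

section OrderComplex
open Set

variable {P : Type} [PartialOrder P]

/-- The chains of `P` contained in `Q`. -/
def chainsIn (Q : Set P) : Set (Set P) := {c | c ⊆ Q ∧ IsChain (· ≤ ·) c}

lemma isLowerSet_chainsIn (Q : Set P) : IsLowerSet (chainsIn Q) :=
  fun _ _ h hc ↦ ⟨h.trans hc.1, hc.2.mono h⟩

lemma IsAbsExtensor.chainsIn_of_cone [Fintype P] {Q : Set P} {r : P} (hr : r ∈ Q)
    (h : ∀ z ∈ Q, z ≤ r ∨ r ≤ z) : IsAbsExtensor (geomReal (chainsIn Q)) := by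
  refine geomReal_of_cone (isLowerSet_chainsIn Q) (y := r)
    ⟨singleton_subset_iff.2 hr, IsChain.singleton⟩ fun c hc ↦ ⟨insert_subset hr hc.1, ?_⟩
  exact hc.2.insert fun z hz _ ↦ (h z (hc.1 hz)).symm

lemma IsAbsExtensor.chainsIn_insert [Fintype P] {Q : Set P}
    (hQ : IsAbsExtensor (geomReal (chainsIn Q))) {x r : P} (hr : r ∈ Q) (hrx : r < x)
    (h : ∀ z ∈ Q, z ≤ x ∨ x ≤ z → z ≤ r ∨ r ≤ z) :
    IsAbsExtensor (geomReal (chainsIn (insert x Q))) := by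
  let L : Set P := {z ∈ Q | z ≤ x ∨ x ≤ z}
  have hrL : r ∈ L := ⟨hr, Or.inl hrx.le⟩
  have hunion : chainsIn (insert x Q) = chainsIn Q ∪ chainsIn (insert x L) := by
    ext c
    constructor
    · rintro ⟨hcQ, hc⟩
      by_cases hx : x ∈ c
      · refine Or.inr ⟨fun z hz ↦ ?_, hc⟩
        rcases hcQ hz with rfl | hzQ
        · exact mem_insert _ _
        · exact Or.inr ⟨hzQ, hc.total hz hx⟩
      · exact Or.inl ⟨(subset_insert_iff_of_notMem hx).1 hcQ, hc⟩
    · rintro (⟨hcQ, hc⟩ | ⟨hcL, hc⟩)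
      · exact ⟨hcQ.trans (subset_insert _ _), hc⟩
      · exact ⟨hcL.trans (insert_subset_insert fun z hz ↦ hz.1), hc⟩
  by_cases hxQ : x ∈ Q
  · rwa [insert_eq_of_mem hxQ]
  have hinter : chainsIn Q ∩ chainsIn (insert x L) = chainsIn L := by
    ext c
    constructor
    · rintro ⟨⟨hcQ, hc⟩, hcL, -⟩
      exact ⟨(subset_insert_iff_of_notMem fun hx ↦ hxQ (hcQ hx)).1 hcL, hc⟩
    · rintro ⟨hcL, hc⟩
      exact ⟨⟨hcL.trans fun z hz ↦ hz.1, hc⟩, hcL.trans (subset_insert _ _), hc⟩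
  rw [hunion, geomReal_union]
  refine hQ.union ?_ ?_ (isClosed_geomReal (isLowerSet_chainsIn _))
    (isClosed_geomReal (isLowerSet_chainsIn _))
  · refine chainsIn_of_cone (r := x) (mem_insert _ _) ?_
    rintro z (rfl | hz)
    · exact Or.inl le_rfl
    · exact hz.2
  · rw [← geomReal_inter, hinter]
    exact chainsIn_of_cone hrL fun z hz ↦ h z hz.1 hz.2

lemma IsAbsExtensor.chainsIn_compl [Fintype P] {s : P} {Y : Set P} (hmin : ∀ y ∈ Y, IsMin y)
    (hs : ∀ y ∈ Y, ¬ y ≤ s)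
    (hr : ∀ x ∉ Y, ¬ x ≤ s → ∃ r, r ≤ x ∧ r ≤ s ∧ ∀ z ≤ x, z ≤ s → z ≤ r) :
    IsAbsExtensor (geomReal (chainsIn Yᶜ)) := by
  have key : ∀ (n : ℕ) (U : Set P), U.ncard = n → IsUpperSet U → (∀ x ∈ U, x ∉ Y ∧ ¬ x ≤ s) →
      IsAbsExtensor (geomReal (chainsIn (Iic s ∪ U))) := by
    intro n
    induction n with
    | zero =>
      intro U hU _ _
      rw [(ncard_eq_zero (toFinite U)).1 hU, union_empty]
      exact chainsIn_of_cone (mem_Iic.2 le_rfl) fun z hz ↦ Or.inl hz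
    | succ n ih =>
      intro U hU hUp hUY
      obtain ⟨x, hx⟩ := U.toFinite.exists_minimal
        (nonempty_of_ncard_ne_zero (by rw [hU]; exact n.succ_ne_zero))
      obtain ⟨r, hrx, hrs, hrz⟩ := hr x (hUY x hx.1).1 (hUY x hx.1).2
      have heq : Iic s ∪ U = insert x (Iic s ∪ U \ {x}) := by
        rw [← union_insert, insert_sdiff_singleton, insert_eq_of_mem hx.1]
      rw [heq]
      have hlt : r < x := lt_of_le_of_ne hrx fun h ↦ (hUY x hx.1).2 (h ▸ hrs)
      refine (ih (U \ {x}) ?_ ?_ fun z hz ↦ hUY z hz.1).chainsIn_insert (r := r) (Or.inl hrs)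
        hlt ?_
      · have := ncard_sdiff_singleton_add_one hx.1 (toFinite U); omega
      · refine fun a b hab ha ↦ ⟨hUp hab ha.1, fun hb ↦ ha.2 ?_⟩
        rw [mem_singleton_iff] at hb ⊢
        exact le_antisymm (hab.trans hb.le) (hx.2 ha.1 (hab.trans hb.le))
      · rintro z hz (hzx | hxz)
        · rcases hz with hz | hz
          · exact Or.inl (hrz z hzx hz)
          · exact absurd (le_antisymm hzx (hx.2 hz.1 hzx)) hz.2
        · exact Or.inr (hrx.trans hxz)
  have heq : Yᶜ = Iic s ∪ {x | x ∉ Y ∧ ¬ x ≤ s} := by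
    ext x
    have := hs x
    simp only [mem_compl_iff, mem_union, mem_Iic, mem_ofPred_eq]
    tauto
  rw [heq]
  refine key _ _ rfl (fun a b hab ha ↦ ⟨fun hb ↦ ?_, fun hb ↦ ha.2 (hab.trans hb)⟩)
    fun x hx ↦ hx
  exact ha.1 (le_antisymm hab (hmin b hb hab) ▸ hb)

end OrderComplex

section Spherical
open Set

lemma geomReal_image_eq {V W : Type} [Fintype V] [Fintype W] {e : V → W}
    (he : Function.Injective e) (K : Set (Set V)) :
    geomReal ((e '' ·) '' K) = (fun w ↦ Function.extend e w 0) '' geomReal K := by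
  have hsupp (w : V → ℝ) : Function.support (Function.extend e w 0) = e '' Function.support w := by
    ext u
    by_cases hu : ∃ v, e v = u
    · obtain ⟨v, rfl⟩ := hu
      simp [he.extend_apply, he.eq_iff]
    · rw [Function.mem_support, Function.extend_apply' _ _ _ hu]
      refine ⟨fun h ↦ absurd rfl h, fun ⟨v, _, hv⟩ ↦ absurd ⟨v, hv⟩ hu⟩
  have hsum (w : V → ℝ) : ∑ v, w v = ∑ u, Function.extend e w 0 u :=
    Fintype.sum_of_injective e he _ _ (fun u hu ↦ Function.extend_apply' _ _ _ hu)
      fun v ↦ (he.extend_apply _ _ _).symm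
  ext w
  constructor
  · rintro ⟨hw, σ, hσ, hσw⟩
    have hw' : Function.extend e (w ∘ e) 0 = w := by
      funext u
      by_cases hu : ∃ v, e v = u
      · obtain ⟨v, rfl⟩ := hu
        exact he.extend_apply _ _ _
      · rw [Function.extend_apply' _ _ _ hu]
        by_contra h
        have : u ∈ e '' σ := hσw.ge (Ne.symm h)
        obtain ⟨v, _, hv⟩ := this
        exact hu ⟨v, hv⟩
    refine ⟨w ∘ e, ⟨⟨fun v ↦ hw.1 _, ?_⟩, ?_⟩, hw'⟩
    · rw [hsum, hw', hw.2]
    · have : e '' Function.support (w ∘ e) = e '' σ := by rw [← hsupp, hw']; exact hσw.symm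
      rwa [he.image_injective this]
  · rintro ⟨w, ⟨hw, hK⟩, rfl⟩
    refine ⟨⟨fun u ↦ ?_, ?_⟩, _, hK, (hsupp w).symm⟩
    · by_cases hu : ∃ v, e v = u
      · obtain ⟨v, rfl⟩ := hu
        simpa [he.extend_apply] using hw.1 v
      · simp [Function.extend_apply' _ _ _ hu]
    · rw [← hsum, hw.2]

lemma IsAbsExtensor.geomReal_image {V W : Type} [Fintype V] [Fintype W] {e : V → W}
    (he : Function.Injective e) {K : Set (Set V)} (hK : IsAbsExtensor (geomReal K)) :
    IsAbsExtensor (geomReal ((e '' ·) '' K)) := by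
  rw [geomReal_image_eq he]
  refine hK.image (j := (· ∘ e)) (continuous_pi fun u ↦ ?_) (by fun_prop)
    fun w _ ↦ Function.extend_comp he _ _
  by_cases hu : ∃ v, e v = u
  · obtain ⟨v, rfl⟩ := hu
    simpa only [he.extend_apply] using continuous_apply v
  · simpa only [Function.extend_apply' _ _ _ hu] using continuous_const

/-- The order complex of `P` becomes an absolute extensor (or void) after removing `k` maximal
chains with `d` elements each. -/
def HasSphericalChains (P : Type) [PartialOrder P] [Fintype P] (d k : ℕ) : Prop :=
  ∃ (ι : Type) (_ : Fintype ι) (F : ι → Set P), Nat.card ι = k ∧ Function.Injective F ∧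
    (∀ i, IsMaxChain (· ≤ ·) (F i) ∧ (F i).ncard = d) ∧
    (chainFaces P \ range F = ∅ ∨ IsAbsExtensor (geomReal (chainFaces P \ range F)))

lemma isLowerSet_chainFaces_diff {P ι : Type} [PartialOrder P] {F : ι → Set P}
    (hF : ∀ i, IsMaxChain (· ≤ ·) (F i)) : IsLowerSet (chainFaces P \ range F) := by
  rintro c c' hc ⟨h1, h2⟩
  refine ⟨IsChain.mono hc h1, ?_⟩
  rintro ⟨i, rfl⟩
  exact h2 ⟨i, (hF i).2 h1 hc⟩

theorem HasSphericalChains.of_isMin {P J : Type} [PartialOrder P] [Fintype P] [Fintype J]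
    {y : J → P} (hy : Function.Injective y) {s : P} (hmin : ∀ j, IsMin (y j))
    (hs : ∀ j, ¬ y j ≤ s)
    (hr : ∀ x ∉ range y, ¬ x ≤ s → ∃ r, r ≤ x ∧ r ≤ s ∧ ∀ z ≤ x, z ≤ s → z ≤ r)
    {P' : J → Type} [∀ j, PartialOrder (P' j)] [∀ j, Fintype (P' j)] (e : ∀ j, P' j ↪o P)
    (he : ∀ j, range (e j) = Ioi (y j)) {d k : ℕ} (h : ∀ j, HasSphericalChains (P' j) d k) :
    HasSphericalChains P (d + 1) (Nat.card J * k) := by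
  classical
  choose ι hι F hcard hinj hmax hAE using h
  have hlt (j : J) (x : P' j) : y j < e j x := (he j).le ⟨x, rfl⟩
  have hne (i j : J) (x : P' j) : y i ≠ e j x := fun h ↦ by
    have h1 := hlt j x
    rw [← h] at h1
    exact h1.not_ge (hmin i h1.le)
  have hdecomp (j : J) {c : Set P} (hc : IsChain (· ≤ ·) c) (hj : y j ∈ c) :
      insert (y j) (e j '' (e j ⁻¹' c)) = c := by
    rw [image_preimage_eq_inter_range, he]
    ext z
    constructor
    · rintro (rfl | hz)
      exacts [hj, hz.1]
    · intro hz
      rcases eq_or_ne z (y j) with rfl | hzy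
      · exact mem_insert _ _
      · refine Or.inr ⟨hz, lt_of_le_of_ne ?_ hzy.symm⟩
        exact (hc.total hj hz).elim id fun h ↦ hmin j h
  have hpre (j : J) (c : Set (P' j)) : e j ⁻¹' (insert (y j) (e j '' c)) = c := by
    ext x
    simp [(hne j j x).symm]
  have hchain_pre (j : J) {c : Set P} (hc : IsChain (· ≤ ·) c) :
      IsChain (· ≤ ·) (e j ⁻¹' c) := fun a ha b hb hab ↦ by
    simpa using hc ha hb ((e j).injective.ne hab)
  have hchain_image (j : J) {c : Set (P' j)} (hc : IsChain (· ≤ ·) c) :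
      IsChain (· ≤ ·) (e j '' c) := by
    rintro _ ⟨a, ha, rfl⟩ _ ⟨b, hb, rfl⟩ hab
    simpa using hc ha hb fun h ↦ hab (by rw [h])
  have hchain_ins (j : J) {c : Set (P' j)} (hc : IsChain (· ≤ ·) c) :
      IsChain (· ≤ ·) (insert (y j) (e j '' c)) := by
    refine (hchain_image j hc).insert ?_
    rintro _ ⟨a, ha, rfl⟩ -
    exact Or.inl (hlt j a).le
  have hmem_ins {i j : J} {c : Set (P' j)} (h : y i ∈ insert (y j) (e j '' c)) : i = j := by
    rcases h with h | ⟨a, _, ha⟩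
    · exact hy h
    · exact absurd ha.symm (hne i j a)
  let F' : (Σ j, ι j) → Set P := fun p ↦ insert (y p.1) (e p.1 '' F p.1 p.2)
  have hmax' (p) : IsMaxChain (· ≤ ·) (F' p) := by
    refine ⟨hchain_ins _ (hmax _ _).1.1, fun t ht hFt ↦ ?_⟩
    rw [← hdecomp p.1 ht (hFt (mem_insert _ _))]
    have : F p.1 p.2 ⊆ e p.1 ⁻¹' t := (hpre p.1 _).ge.trans (preimage_mono hFt)
    rw [← (hmax p.1 p.2).1.2 (hchain_pre p.1 ht) this]
  refine ⟨Σ j, ι j, inferInstance, F', ?_, ?_, fun p ↦ ⟨hmax' p, ?_⟩, Or.inr ?_⟩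
  · rw [Nat.card_sigma]
    simp only [hcard]
    simp
  · rintro ⟨i, a⟩ ⟨j, b⟩ hab
    obtain rfl : i = j := hmem_ins (hab.le (mem_insert _ _))
    have := congrArg (fun c ↦ e i ⁻¹' c) hab
    simp only [F', hpre] at this
    rw [hinj i this]
  · rw [ncard_insert_of_notMem, ncard_image_of_injective _ (e p.1).injective, (hmax _ _).2]
    rintro ⟨a, _, ha⟩
    exact hne _ _ _ ha.symm
  let X : Finset J → Set (Set P) := fun T ↦ {c ∈ chainFaces P \ range F' | ∀ j, y j ∈ c → j ∈ T}
  have hX (T) : IsLowerSet (X T) := fun c c' hc h ↦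
    ⟨isLowerSet_chainFaces_diff hmax' hc h.1, fun j hj ↦ h.2 j (hc hj)⟩
  suffices hXT : ∀ T, IsAbsExtensor (geomReal (X T)) by
    convert hXT Finset.univ using 2
    exact subset_antisymm (fun c hc ↦ ⟨hc, fun j _ ↦ Finset.mem_univ j⟩) fun c hc ↦ hc.1
  intro T
  induction T using Finset.induction_on with
  | empty =>
    convert IsAbsExtensor.chainsIn_compl (Y := range y) (s := s) (by simpa using hmin)
      (by simpa using hs) hr using 2
    ext c
    refine ⟨fun hc ↦ ⟨?_, hc.1.1⟩, fun hc ↦ ⟨⟨hc.2, ?_⟩, fun j hj ↦ absurd ⟨j, rfl⟩ (hc.1 hj)⟩⟩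
    · rintro z hz ⟨j, rfl⟩
      simpa using hc.2 j hz
    · rintro ⟨p, rfl⟩
      exact hc.1 (mem_insert (y p.1) _) ⟨_, rfl⟩
  | insert j T hjT ih =>
    set K := chainFaces (P' j) \ range (F j) with hKdef
    have hK : IsLowerSet K := isLowerSet_chainFaces_diff fun i ↦ (hmax j i).1
    let Z : Set (Set P) := {c | ∃ c' ∈ K, c ⊆ insert (y j) (e j '' c')}
    have hZ : IsLowerSet Z := fun c c' hc ⟨a, ha, hca⟩ ↦ ⟨a, ha, subset_trans hc hca⟩
    have hunion : X (insert j T) = X T ∪ Z := by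
      ext c
      constructor
      · intro hc
        by_cases hj : y j ∈ c
        · refine Or.inr ⟨e j ⁻¹' c, ⟨hchain_pre j hc.1.1, ?_⟩, (hdecomp j hc.1.1 hj).ge⟩
          rintro ⟨i, hi⟩
          refine hc.1.2 ⟨⟨j, i⟩, ?_⟩
          simp only [F', hi, hdecomp j hc.1.1 hj]
        · refine Or.inl ⟨hc.1, fun i hi ↦ ?_⟩
          rcases Finset.mem_insert.1 (hc.2 i hi) with rfl | h
          exacts [absurd hi hj, h]
      · rintro (hc | ⟨c', hc', hcc'⟩)
        · exact ⟨hc.1, fun i hi ↦ Finset.mem_insert_of_mem (hc.2 i hi)⟩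
        · refine ⟨⟨IsChain.mono hcc' (hchain_ins j hc'.1), ?_⟩, fun i hi ↦ ?_⟩
          · rintro ⟨⟨i, a⟩, rfl⟩
            have h1 := (hmax' ⟨i, a⟩).2 (hchain_ins j hc'.1) hcc'
            obtain rfl : i = j := hmem_ins (h1.le (mem_insert _ _))
            have := congrArg (fun c ↦ e i ⁻¹' c) h1
            simp only [F', hpre] at this
            exact hc'.2 ⟨a, this⟩
          · rw [hmem_ins (hcc' hi)]
            exact Finset.mem_insert_self _ _
    have hinter : X T ∩ Z = (e j '' ·) '' K := by
      ext c
      constructor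
      · rintro ⟨hc, c', hc', hcc'⟩
        rw [subset_insert_iff_of_notMem fun hj ↦ hjT (hc.2 j hj)] at hcc'
        refine ⟨e j ⁻¹' c, hK ?_ hc', ?_⟩
        · exact (preimage_mono hcc').trans (preimage_image_eq _ (e j).injective).le
        · exact image_preimage_eq_of_subset (hcc'.trans (image_subset_range _ _))
      · rintro ⟨c', hc', rfl⟩
        refine ⟨⟨⟨hchain_image j hc'.1, ?_⟩, ?_⟩, c', hc', subset_insert _ _⟩
        · rintro ⟨p, hp⟩
          obtain ⟨a, _, ha⟩ := hp.le (mem_insert (y p.1) _)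
          exact hne _ _ _ ha.symm
        · rintro i ⟨a, _, ha⟩
          exact absurd ha.symm (hne _ _ _)
    rw [hunion]
    rcases hAE j with h0 | h1
    · have : Z = ∅ := by
        refine eq_empty_of_forall_notMem fun c ⟨c', hc', _⟩ ↦ ?_
        rw [hKdef, h0] at hc'
        exact hc'
      rwa [this, union_empty]
    · rw [geomReal_union]
      refine ih.union ?_ ?_ (isClosed_geomReal (hX T)) (isClosed_geomReal hZ)
      · obtain ⟨w, hw⟩ := h1.nonempty
        refine IsAbsExtensor.geomReal_of_cone hZ (y := y j)
          ⟨_, hw.2, singleton_subset_iff.2 (mem_insert _ _)⟩ ?_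
        rintro c ⟨c', hc', hcc'⟩
        exact ⟨c', hc', insert_subset (mem_insert _ _) hcc'⟩
      · rw [← geomReal_inter, hinter]
        exact h1.geomReal_image (e j).injective

end Spherical

section ProperSetoid
open Set

/-- The proper nontrivial equivalence relations on `α`. -/
abbrev ProperSetoid (α : Type) : Type := {s : Setoid α // s ≠ ⊥ ∧ s ≠ ⊤}

instance Setoid.finite (α : Type) [Finite α] : Finite (Setoid α) :=
  Finite.of_injective (fun s : Setoid α ↦ (s.r : α → α → Prop)) fun _ _ h ↦
    Setoid.ext fun a b ↦ iff_of_eq (congrFun (congrFun h a) b)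

variable {α : Type}

lemma Setoid.exists_rel_of_ne_bot {s : Setoid α} (hs : s ≠ ⊥) : ∃ x y, x ≠ y ∧ s x y := by
  by_contra! h
  exact hs (eq_bot_iff.2 fun x y hxy ↦ by
    by_contra hne
    exact h x y hne hxy)

lemma Setoid.ne_bot_of_rel {s : Setoid α} {x y : α} (hxy : x ≠ y) (h : s x y) : s ≠ ⊥ := by
  rintro rfl
  exact hxy h

lemma Setoid.ne_top_of_not_rel {s : Setoid α} {x y : α} (h : ¬ s x y) : s ≠ ⊤ := by
  rintro rfl
  exact h trivial

lemma Setoid.exists_not_rel_of_ne_top {s : Setoid α} (hs : s ≠ ⊤) : ∃ x y, ¬ s x y := by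
  by_contra! h
  exact hs (Setoid.eq_top_iff.2 h)

/-- The equivalence relation whose only possibly nontrivial class is `{a, b}`. -/
def Setoid.pair (a b : α) : Setoid α where
  r x y := x = y ∨ (x = a ∨ x = b) ∧ (y = a ∨ y = b)
  iseqv := ⟨fun _ ↦ Or.inl rfl, by rintro x y (rfl | h); exacts [Or.inl rfl, Or.inr h.symm], by
    rintro x y z (rfl | h) (rfl | h')
    exacts [Or.inl rfl, Or.inr h', Or.inr h, Or.inr ⟨h.1, h'.2⟩]⟩

lemma Setoid.pair_rel {a b x y : α} :
    Setoid.pair a b x y ↔ x = y ∨ (x = a ∨ x = b) ∧ (y = a ∨ y = b) := Iff.rfl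

lemma Setoid.pair_le_iff {a b : α} {s : Setoid α} : Setoid.pair a b ≤ s ↔ s a b := by
  refine ⟨fun h ↦ h (Or.inr ⟨Or.inl rfl, Or.inr rfl⟩), fun h x y hxy ↦ ?_⟩
  rcases hxy with rfl | ⟨rfl | rfl, rfl | rfl⟩
  exacts [s.refl _, s.refl _, h, s.symm h, s.refl _]

/-- Proper equivalence relations on the quotient by `y`, pulled back to `α`. -/
def ProperSetoid.quotientEmbedding (y : ProperSetoid α) :
    ProperSetoid (Quotient y.1) ↪o ProperSetoid α where
  toFun t := ⟨Setoid.comap (Quotient.mk y.1) t.1, by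
    obtain ⟨u, v, huv, h⟩ := Setoid.exists_rel_of_ne_bot t.2.1
    obtain ⟨x, rfl⟩ := Quotient.exists_rep u
    obtain ⟨z, rfl⟩ := Quotient.exists_rep v
    exact Setoid.ne_bot_of_rel (x := x) (y := z) (fun hxz ↦ huv (by rw [hxz])) h, by
    obtain ⟨u, v, h⟩ := Setoid.exists_not_rel_of_ne_top t.2.2
    obtain ⟨x, rfl⟩ := Quotient.exists_rep u
    obtain ⟨z, rfl⟩ := Quotient.exists_rep v
    exact Setoid.ne_top_of_not_rel (x := x) (y := z) h⟩
  inj' s t h := by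
    refine Subtype.ext (Setoid.ext fun u v ↦ ?_)
    obtain ⟨x, rfl⟩ := Quotient.exists_rep u
    obtain ⟨z, rfl⟩ := Quotient.exists_rep v
    exact Setoid.ext_iff.1 (congrArg Subtype.val h) x z
  map_rel_iff' {s t} := by
    refine ⟨fun h u v ↦ ?_, fun h x z hxz ↦ h hxz⟩
    obtain ⟨x, rfl⟩ := Quotient.exists_rep u
    obtain ⟨z, rfl⟩ := Quotient.exists_rep v
    exact fun hxz ↦ h hxz

lemma ProperSetoid.range_quotientEmbedding (y : ProperSetoid α) :
    range y.quotientEmbedding = Ioi y := by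
  ext z
  constructor
  · rintro ⟨t, rfl⟩
    have hle : y.1 ≤ (y.quotientEmbedding t).1 := fun {u v} huv ↦ by
      change t.1 _ _
      rw [Quotient.sound huv]
    refine lt_of_le_not_ge hle fun h ↦ ?_
    obtain ⟨u, v, huv, ht⟩ := Setoid.exists_rel_of_ne_bot t.2.1
    obtain ⟨x, rfl⟩ := Quotient.exists_rep u
    obtain ⟨w, rfl⟩ := Quotient.exists_rep v
    exact huv (Quotient.sound (h ht))
  · intro hz
    have hle : y.1 ≤ z.1 := hz.le
    let t : Setoid (Quotient y.1) := Setoid.correspondence y.1 ⟨z.1, hle⟩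
    have ht (u v : α) : t (Quotient.mk _ u) (Quotient.mk _ v) ↔ z.1 u v := Iff.rfl
    refine ⟨⟨t, ?_, ?_⟩, Subtype.ext (Setoid.ext fun u v ↦ Iff.rfl)⟩
    · intro h0
      have hge : z.1 ≤ y.1 := fun {u v} huv ↦ by
        have := (ht u v).2 huv
        rw [h0] at this
        exact Quotient.exact this
      exact hz.not_ge hge
    · obtain ⟨u, v, h⟩ := Setoid.exists_not_rel_of_ne_top z.2.2
      exact Setoid.ne_top_of_not_rel (mt (ht u v).1 h)

lemma Setoid.card_quotient_pair {a b : α} (hab : b ≠ a) :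
    Nat.card (Quotient (Setoid.pair a b)) = Nat.card {c // c ≠ a} := by
  refine (Nat.card_congr (Equiv.ofBijective (fun c : {c // c ≠ a} ↦ Quotient.mk _ c.1)
    ⟨fun c c' h ↦ ?_, fun q ↦ ?_⟩)).symm
  · rcases Quotient.exact h with h | ⟨h, h'⟩
    · exact Subtype.ext h
    · exact Subtype.ext ((h.resolve_left c.2).trans (h'.resolve_left c'.2).symm)
  · obtain ⟨x, rfl⟩ := Quotient.exists_rep q
    by_cases hx : x = a
    · exact ⟨⟨b, hab⟩, Quotient.sound (Or.inr ⟨Or.inr rfl, Or.inl hx⟩)⟩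
    · exact ⟨⟨x, hx⟩, rfl⟩

theorem hasSphericalChains_properSetoid (m : ℕ) : ∀ (α : Type) [Finite α]
    [Fintype (ProperSetoid α)], Nat.card α = m + 2 →
    HasSphericalChains (ProperSetoid α) m (m + 1).factorial := by
  classical
  induction m with
  | zero =>
    intro α _ _ hα
    obtain ⟨x, y, hxy, huniv⟩ := Nat.card_eq_two_iff.1 hα
    have : IsEmpty (ProperSetoid α) := ⟨fun ⟨s, hbot, htop⟩ ↦ by
      obtain ⟨u, v, huv, h⟩ := Setoid.exists_rel_of_ne_bot hbot
      have hs : s x y := by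
        have hu : u ∈ ({x, y} : Set α) := huniv.ge (mem_univ u)
        have hv : v ∈ ({x, y} : Set α) := huniv.ge (mem_univ v)
        rcases hu with rfl | rfl <;> rcases hv with rfl | rfl
        exacts [absurd rfl huv, h, s.symm h, absurd rfl huv]
      obtain ⟨u, v, h⟩ := Setoid.exists_not_rel_of_ne_top htop
      have hu : u ∈ ({x, y} : Set α) := huniv.ge (mem_univ u)
      have hv : v ∈ ({x, y} : Set α) := huniv.ge (mem_univ v)
      rcases hu with rfl | rfl <;> rcases hv with rfl | rfl
      exacts [h (s.refl _), h hs, h (s.symm hs), h (s.refl _)]⟩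
    refine ⟨Unit, inferInstance, fun _ ↦ ∅, by simp, fun _ _ _ ↦ rfl, fun _ ↦
      ⟨⟨IsChain.empty, fun t _ _ ↦ Subsingleton.elim _ _⟩, ncard_empty _⟩, Or.inl ?_⟩
    rw [sdiff_eq_empty]
    exact fun c _ ↦ ⟨(), Subsingleton.elim _ _⟩
  | succ m ih =>
    intro α _ _ hα
    have : Fintype α := Fintype.ofFinite α
    have hcard : Fintype.card α = m + 3 := by rw [← Nat.card_eq_fintype_card, hα]
    obtain ⟨a⟩ : Nonempty α := Fintype.card_pos_iff.1 (by omega)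
    have hthird (b : α) : ∃ c, c ≠ a ∧ c ≠ b := by
      have : ({a, b} : Finset α).card < Fintype.card α := (Finset.card_le_two).trans_lt (by omega)
      obtain ⟨c, hc⟩ := Finset.exists_mem_notMem_of_card_lt_card (t := Finset.univ) this
      exact ⟨c, by simpa using hc.2⟩
    let J : Type := {b : α // b ≠ a}
    have hJ : Nat.card J = m + 2 := by
      rw [Nat.card_eq_fintype_card, Fintype.card_subtype_compl, hcard, Fintype.card_subtype_eq]
      omega
    have hpair {b : α} : Setoid.pair a b a b := Or.inr ⟨Or.inl rfl, Or.inr rfl⟩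
    let y : J → ProperSetoid α := fun b ↦
      ⟨Setoid.pair a b.1, Setoid.ne_bot_of_rel b.2.symm hpair, by
      obtain ⟨c, hca, hcb⟩ := hthird b.1
      refine Setoid.ne_top_of_not_rel (x := a) (y := c) ?_
      rw [Setoid.pair_rel]
      tauto⟩
    obtain ⟨b₀, hb₀, -⟩ := hthird a
    obtain ⟨c₀, hc₀, hbc₀⟩ := hthird b₀
    have hbot {x : Setoid α} {u v : α} (huv : u ≠ v) (h : x u v) (hu : u ≠ a) (hv : v ≠ a) :
        x ⊓ Setoid.ker (· = a) ≠ ⊥ :=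
      Setoid.ne_bot_of_rel huv ⟨h, by simp [Setoid.ker_def, hu, hv]⟩
    have htop : Setoid.ker (· = a) ≠ ⊤ :=
      Setoid.ne_top_of_not_rel (x := a) (y := b₀) (by simp [Setoid.ker_def, hb₀])
    let s : ProperSetoid α := ⟨Setoid.ker (· = a), by
      have := hbot (x := ⊤) hbc₀ trivial hc₀ hb₀
      rwa [top_inf_eq] at this, htop⟩
    have hfin (j : J) : Fintype (ProperSetoid (Quotient (y j).1)) := Fintype.ofFinite _
    have key := HasSphericalChains.of_isMin (y := y) (s := s) (d := m) (k := (m + 1).factorial)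
      ?_ ?_ ?_ ?_ (fun j ↦ (y j).quotientEmbedding) (fun j ↦ (y j).range_quotientEmbedding)
      (fun j ↦ ih _ ((Setoid.card_quotient_pair j.2).trans hJ))
    · rwa [hJ, ← Nat.factorial_succ] at key
    · intro b c hbc
      have h : Setoid.pair a c.1 a b.1 :=
        Setoid.pair_le_iff.1 (congrArg Subtype.val hbc).le
      rcases h with h | ⟨-, h⟩
      · exact absurd h.symm b.2
      · exact Subtype.ext (h.resolve_left b.2)
    · intro b t ht
      refine Setoid.pair_le_iff.2 ?_
      obtain ⟨u, v, huv, h⟩ := Setoid.exists_rel_of_ne_bot t.2.1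
      rcases ht h with h' | ⟨rfl | rfl, rfl | rfl⟩
      exacts [absurd h' huv, absurd rfl huv, h, t.1.symm h, absurd rfl huv]
    · intro b hb
      have : (a = a) = (b.1 = a) := Setoid.pair_le_iff.1 hb
      exact b.2 (this.mp rfl)
    · intro x hx hxs
      have hxs' : ∃ b, b ≠ a ∧ x.1 a b := by
        by_contra! hcon
        refine hxs fun u v huv ↦ propext ⟨?_, ?_⟩
        · rintro rfl
          by_contra hv
          exact hcon v hv huv
        · rintro rfl
          by_contra hu
          exact hcon u hu (x.1.symm huv)
      obtain ⟨b, hba, hab⟩ := hxs'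
      have hnle : ¬ x.1 ≤ Setoid.pair a b := fun h ↦
        hx ⟨⟨b, hba⟩, Subtype.ext (le_antisymm (Setoid.pair_le_iff.2 hab) h)⟩
      have hne : x.1 ⊓ Setoid.ker (· = a) ≠ ⊥ := by
        by_contra h0
        refine hnle fun u v huv ↦ ?_
        have hb (w : α) (hw : x.1 a w) : w = a ∨ w = b := by
          by_contra! hwn
          exact hbot hwn.2.symm (x.1.trans (x.1.symm hab) hw) hba hwn.1 h0
        by_cases hua : u = a
        · subst hua
          exact Or.inr ⟨Or.inl rfl, hb v huv⟩
        by_cases hva : v = a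
        · subst hva
          exact Or.inr ⟨hb u (x.1.symm huv), Or.inl rfl⟩
        refine Or.inl ?_
        by_contra huv'
        exact hbot huv' huv hua hva h0
      exact ⟨⟨_, hne, fun h ↦ htop (top_le_iff.1 (h.ge.trans inf_le_right))⟩,
        inf_le_left (a := x.1), inf_le_right (a := x.1), fun z hzx hzs ↦
          Subtype.coe_le_coe.1 (le_inf hzx hzs)⟩

end ProperSetoid

section RemoveFacets
open Set

variable {V : Type} [Fintype V]

lemma isAbsExtensor_prism {σ : Set V} (hσ : σ.Nonempty) :
    IsAbsExtensor (face σ ×ˢ {(0 : ℝ)} ∪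
      ⋃ v ∈ (toFinite σ).toFinset, face (σ \ {v}) ×ˢ Icc (0 : ℝ) 1) := by
  classical
  have hI : ({0} : Set ℝ) ∩ Icc 0 1 = {0} :=
    inter_eq_left.2 (singleton_subset_iff.2 (left_mem_Icc.2 zero_le_one))
  refine IsAbsExtensor.biUnion (Good := fun S ↦ ∃ τ : Set V,
    S = face τ ×ˢ {(0 : ℝ)} ∨ S = face τ ×ˢ Icc (0 : ℝ) 1) ?_ ?_ ?_
    (fun z ↦ (z.1, 0)) _ _ _ ⟨_, Or.inl rfl⟩ ?_ (fun v _ ↦ ⟨_, Or.inr rfl⟩) ?_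
  · rintro _ _ ⟨τ, rfl | rfl⟩ ⟨τ', rfl | rfl⟩ <;> refine ⟨τ ∩ τ', ?_⟩ <;>
      rw [prod_inter_prod, face_inter]
    · exact Or.inl (by rw [inter_self])
    · exact Or.inl (by rw [hI])
    · exact Or.inl (by rw [inter_comm (Icc (0 : ℝ) 1), hI])
    · exact Or.inr (by rw [inter_self])
  · rintro _ ⟨τ, rfl | rfl⟩
    · exact (isClosed_face τ).prod isClosed_singleton
    · exact (isClosed_face τ).prod isClosed_Icc
  · rintro _ ⟨τ, rfl | rfl⟩ hne
    · exact (IsAbsExtensor.face (nonempty_of_face_nonempty hne.fst)).prod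
        (IsAbsExtensor.singleton 0)
    · exact (IsAbsExtensor.face (nonempty_of_face_nonempty hne.fst)).prod IsAbsExtensor.Icc
  · obtain ⟨v, hv⟩ := hσ
    exact ⟨(Pi.single v 1, 0), single_mem_face hv, rfl⟩
  · rintro v - ⟨w, t⟩ ⟨hw, ht⟩
    exact ⟨⟨hw, left_mem_Icc.2 zero_le_one⟩, face_mono sdiff_subset hw, rfl⟩

/-- If removing the maximal faces `F i` from `K` leaves an absolute extensor, then that subcomplex
can be contracted inside itself by a homotopy of the whole complex. -/
theorem exists_homotopy_of_isAbsExtensor {K : Set (Set V)} (hK : IsLowerSet K) {ι : Type}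
    [Finite ι] {F : ι → Set V} (hinj : Function.Injective F)
    (hmax : ∀ i, F i ∈ K ∧ ∀ σ ∈ K, F i ⊆ σ → F i = σ)
    (hAE : IsAbsExtensor (geomReal (K \ range F))) :
    ∃ H : (V → ℝ) × ℝ → V → ℝ, ContinuousOn H (geomReal K ×ˢ Icc 0 1) ∧
      MapsTo H (geomReal K ×ˢ Icc 0 1) (geomReal K) ∧
      MapsTo H (geomReal (K \ range F) ×ˢ Icc 0 1) (geomReal (K \ range F)) ∧
      (∀ w ∈ geomReal K, H (w, 0) = w) ∧
      ∃ p ∈ geomReal (K \ range F), ∀ w ∈ geomReal (K \ range F), H (w, 1) = p := by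
  classical
  have hK' : IsLowerSet (K \ range F) := by
    rintro σ τ hτ ⟨h1, h2⟩
    refine ⟨hK hτ h1, ?_⟩
    rintro ⟨i, rfl⟩
    exact h2 ⟨i, (hmax i).2 _ h1 hτ⟩
  set X' := geomReal (K \ range F) with hX'def
  have hX'c : IsClosed X' := isClosed_geomReal hK'
  have hX'K : X' ⊆ geomReal K := fun w hw ↦ ⟨hw.1, hw.2.1⟩
  obtain ⟨p, hp⟩ := hAE.nonempty
  have hI0 : (0 : ℝ) ∈ Icc (0 : ℝ) 1 := left_mem_Icc.2 zero_le_one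
  obtain ⟨G, hG, hGX, hGf⟩ := hAE ((V → ℝ) × ℝ) (X' ×ˢ {0} ∪ X' ×ˢ {1})
    ((hX'c.prod isClosed_singleton).union (hX'c.prod isClosed_singleton))
    (fun z ↦ if z.2 = 0 then z.1 else p)
    (ContinuousOn.union_of_isClosed
      (continuousOn_fst.congr fun z hz ↦ by simp [show z.2 = 0 from hz.2])
      (continuousOn_const (c := p) |>.congr fun z hz ↦ by simp [show z.2 = 1 from hz.2])
      (hX'c.prod isClosed_singleton) (hX'c.prod isClosed_singleton))
    (by
      rintro ⟨w, t⟩ h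
      dsimp only
      split_ifs
      · rcases h with h | h <;> exact h.1
      · exact hp)
  have hG0 : ∀ w ∈ X', G (w, 0) = w := fun w hw ↦ by
    simpa using hGf (x := (w, 0)) (Or.inl ⟨hw, rfl⟩)
  have hG1 : ∀ w ∈ X', G (w, 1) = p := fun w hw ↦ by
    simpa using hGf (x := (w, 1)) (Or.inr ⟨hw, rfl⟩)
  have hbdry {i : ι} {w : V → ℝ} (hw : w ∈ face (F i)) (hne : Function.support w ≠ F i) :
      w ∈ X' := by
    refine ⟨hw.1, hK hw.2 (hmax i).1, ?_⟩
    rintro ⟨j, hj⟩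
    have h1 : F j = F i := (hmax j).2 _ (hmax i).1 (hj ▸ hw.2)
    exact hne (hj ▸ h1)
  have hFne (i : ι) : (F i).Nonempty := by
    by_contra! h0
    refine hp.2.2 ⟨i, (hmax i).2 _ hp.2.1 (h0 ▸ empty_subset _)⟩
  let D : ι → Set ((V → ℝ) × ℝ) := fun i ↦ face (F i) ×ˢ {(0 : ℝ)} ∪
      ⋃ v ∈ (toFinite (F i)).toFinset, face (F i \ {v}) ×ˢ Icc (0 : ℝ) 1
  have hD (i : ι) : IsAbsExtensor (D i) := isAbsExtensor_prism (hFne i)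
  have hDc (i : ι) : IsClosed (D i) := ((isClosed_face _).prod isClosed_singleton).union
    ((Finset.finite_toSet _).isClosed_biUnion fun v _ ↦ (isClosed_face _).prod isClosed_Icc)
  have hD0 {i : ι} {z : (V → ℝ) × ℝ} (hz : z ∈ D i) :
      z ∈ face (F i) ×ˢ {(0 : ℝ)} ∨ z ∈ X' ×ˢ Icc (0 : ℝ) 1 := by
    refine hz.imp id fun h ↦ ?_
    simp only [mem_iUnion] at h
    obtain ⟨v, hv, hz⟩ := h
    refine ⟨hbdry (face_mono sdiff_subset hz.1) fun h ↦ ?_, hz.2⟩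
    exact (h.ge.trans hz.1.2 (by simpa using hv)).2 rfl
  have hD1 {i : ι} {w : V → ℝ} {t : ℝ} (hw : w ∈ face (F i)) (hne : Function.support w ≠ F i)
      (ht : t ∈ Icc (0 : ℝ) 1) : (w, t) ∈ D i := by
    obtain ⟨v, hv, hvw⟩ := exists_of_ssubset (hw.2.ssubset_of_ne hne)
    refine Or.inr (mem_biUnion (x := v) (by simpa using hv)
      ⟨⟨hw.1, fun u hu ↦ ⟨hw.2 hu, ?_⟩⟩, ht⟩)
    rintro rfl
    exact hvw hu
  choose ρ hρ hρD hρid using fun i ↦ hD i ((V → ℝ) × ℝ) (D i) (hDc i) id continuousOn_id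
    (mapsTo_id _)
  let Γ : (V → ℝ) × ℝ → V → ℝ := fun z ↦ if z.2 = 0 then z.1 else G z
  have hΓG {z : (V → ℝ) × ℝ} (hz : z.1 ∈ X') : Γ z = G z := by
    obtain ⟨w, t⟩ := z
    by_cases ht : t = 0
    · subst ht
      simpa [Γ] using (hG0 w hz).symm
    · simp [Γ, ht]
  have hΓ (i : ι) : ContinuousOn Γ (D i) := by
    have h1 : ContinuousOn Γ (face (F i) ×ˢ {(0 : ℝ)}) :=
      continuousOn_fst.congr fun z hz ↦ by simp [Γ, show z.2 = 0 from hz.2]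
    have h2 : ContinuousOn Γ (X' ×ˢ Icc (0 : ℝ) 1) :=
      hG.continuousOn.congr fun z hz ↦ hΓG hz.1
    exact (h1.union_of_isClosed h2 ((isClosed_face _).prod isClosed_singleton)
      (hX'c.prod isClosed_Icc)).mono fun z hz ↦ hD0 hz
  have hΓK {i : ι} {z} (hz : z ∈ D i) : Γ z ∈ geomReal K := by
    rcases hD0 hz with h | h
    · have : Γ z = z.1 := by simp [Γ, show z.2 = 0 from h.2]
      rw [this]
      exact ⟨h.1.1, hK h.1.2 (hmax i).1⟩
    · rw [hΓG h.1]
      exact hX'K (hGX z)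
  let H : (V → ℝ) × ℝ → V → ℝ := fun z ↦
    if h : ∃ i, Function.support z.1 = F i then Γ (ρ h.choose z) else G z
  have hH' {z : (V → ℝ) × ℝ} (hz : z.1 ∈ X') : H z = G z :=
    dif_neg fun ⟨i, hi⟩ ↦ hz.2.2 ⟨i, hi.symm⟩
  have hHi {i : ι} {z : (V → ℝ) × ℝ} (hz : z.1 ∈ face (F i)) (hz2 : z.2 ∈ Icc (0 : ℝ) 1) :
      H z = Γ (ρ i z) := by
    by_cases hi : Function.support z.1 = F i
    · have h : ∃ i, Function.support z.1 = F i := ⟨i, hi⟩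
      have : h.choose = i := hinj (h.choose_spec.symm.trans hi)
      simp only [H, dif_pos h, this]
    · rw [hH' (hbdry hz hi), hρid i (hD1 hz hi hz2), id, hΓG (hbdry hz hi)]
  have hcover : geomReal K ⊆ X' ∪ ⋃ i, face (F i) := fun w hw ↦ by
    by_cases h : Function.support w ∈ range F
    · obtain ⟨i, hi⟩ := h
      exact Or.inr (mem_iUnion.2 ⟨i, hw.1, hi.ge⟩)
    · exact Or.inl ⟨hw.1, hw.2, h⟩
  refine ⟨H, ?_, ?_, fun z hz ↦ by rw [hH' hz.1]; exact hGX z, ?_, p, hp,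
    fun w hw ↦ by rw [hH' hw, hG1 w hw]⟩
  · have h1 : ContinuousOn H (X' ×ˢ Icc 0 1) := hG.continuousOn.congr fun z hz ↦ hH' hz.1
    have h2 : ContinuousOn H (⋃ i, face (F i) ×ˢ Icc 0 1) := by
      refine LocallyFinite.continuousOn_iUnion (locallyFinite_of_finite _)
        (fun i ↦ (isClosed_face _).prod isClosed_Icc) fun i ↦ ?_
      exact ((hΓ i).comp (hρ i).continuousOn fun z _ ↦ hρD i z).congr fun z hz ↦ hHi hz.1 hz.2
    refine (h1.union_of_isClosed h2 (hX'c.prod isClosed_Icc)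
      (isClosed_iUnion_of_finite fun i ↦ (isClosed_face _).prod isClosed_Icc)).mono ?_
    rw [← iUnion_prod_const, ← union_prod]
    exact prod_mono hcover Subset.rfl
  · rintro z ⟨hz, hz2⟩
    rcases hcover hz with h | h
    · rw [hH' h]
      exact hX'K (hGX z)
    · obtain ⟨i, hi⟩ := mem_iUnion.1 h
      rw [hHi hi hz2]
      exact hΓK (hρD i z)
  · intro w hw
    rcases hcover hw with h | h
    · rw [hH' h, hG0 w h]
    · obtain ⟨i, hi⟩ := mem_iUnion.1 h
      rw [hHi (z := (w, 0)) hi hI0, hρid i (x := (w, 0)) (Or.inl ⟨hi, rfl⟩)]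
      simp [Γ]

end RemoveFacets

section Collapse
open Set OnePoint Topology

variable {U X : Type}

/-- The map to the one-point compactification of `U` collapsing the complement of `j`. -/
noncomputable def collapse (j : U → X) (x : X) : OnePoint U :=
  open Classical in if h : ∃ u, j u = x then (h.choose : OnePoint U) else ∞

lemma collapse_apply {j : U → X} (hj : Function.Injective j) (u : U) :
    collapse j (j u) = (u : OnePoint U) := by
  have h : ∃ u', j u' = j u := ⟨u, rfl⟩
  rw [collapse, dif_pos h, hj h.choose_spec]

lemma collapse_of_notMem {j : U → X} {x : X} (hx : x ∉ range j) : collapse j x = ∞ :=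
  dif_neg hx

lemma collapse_eq_infty_iff {j : U → X} (hj : Function.Injective j) {x : X} :
    collapse j x = ∞ ↔ x ∉ range j := by
  refine ⟨?_, collapse_of_notMem⟩
  rintro h ⟨u, rfl⟩
  rw [collapse_apply hj] at h
  exact coe_ne_infty u h

lemma collapse_eq_iff {j : U → X} (hj : Function.Injective j) {x y : X} :
    collapse j x = collapse j y ↔ x = y ∨ x ∉ range j ∧ y ∉ range j := by
  by_cases hx : x ∈ range j
  · obtain ⟨u, rfl⟩ := hx
    by_cases hy : y ∈ range j
    · obtain ⟨v, rfl⟩ := hy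
      simp [collapse_apply hj, hj.eq_iff]
    · rw [collapse_apply hj, collapse_of_notMem hy]
      simp only [coe_ne_infty, mem_range_self, not_true_eq_false, false_and, or_false, false_iff]
      rintro rfl
      exact hy ⟨u, rfl⟩
  · rw [collapse_of_notMem hx, eq_comm, collapse_eq_infty_iff hj]
    refine ⟨fun h ↦ Or.inr ⟨hx, h⟩, ?_⟩
    rintro (rfl | h)
    exacts [hx, h.2]

lemma collapse_surjective {j : U → X} (hj : Function.Injective j) {p : X} (hp : p ∉ range j) :
    Function.Surjective (collapse j) := fun z ↦ by
  induction z using OnePoint.rec with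
  | infty => exact ⟨p, collapse_of_notMem hp⟩
  | coe u => exact ⟨j u, collapse_apply hj u⟩

variable [TopologicalSpace U] [TopologicalSpace X]

lemma continuous_collapse [T2Space X] {j : U → X} (hj : IsOpenEmbedding j) :
    Continuous (collapse j) := by
  refine continuous_def.2 fun s hs ↦ ?_
  have hmem (u : U) : j u ∈ collapse j ⁻¹' s ↔ (u : OnePoint U) ∈ s := by
    rw [mem_preimage, collapse_apply hj.injective]
  by_cases h : ∞ ∈ s
  · have : (collapse j ⁻¹' s)ᶜ = j '' ((↑) ⁻¹' s : Set U)ᶜ := by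
      ext x
      by_cases hx : x ∈ range j
      · obtain ⟨u, rfl⟩ := hx
        rw [mem_compl_iff, hmem, hj.injective.mem_set_image]
        rfl
      · refine ⟨fun h' ↦ absurd ?_ h', fun ⟨u, _, hu⟩ ↦ absurd ⟨u, hu⟩ hx⟩
        rwa [mem_preimage, collapse_of_notMem hx]
    rw [← isClosed_compl_iff, this]
    exact (((isOpen_iff_of_mem' h).1 hs).1.image hj.continuous).isClosed
  · have : collapse j ⁻¹' s = j '' ((↑) ⁻¹' s : Set U) := by
      ext x
      by_cases hx : x ∈ range j
      · obtain ⟨u, rfl⟩ := hx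
        rw [hmem, hj.injective.mem_set_image]
        rfl
      · refine ⟨fun h' ↦ absurd ?_ h, fun ⟨u, _, hu⟩ ↦ absurd ⟨u, hu⟩ hx⟩
        rwa [mem_preimage, collapse_of_notMem hx] at h'
    rw [this]
    exact hj.isOpenMap _ ((isOpen_iff_of_notMem h).1 hs)

lemma isQuotientMap_collapse [CompactSpace X] [T2Space X] [T2Space U] [WeaklyLocallyCompactSpace U]
    {j : U → X} (hj : IsOpenEmbedding j) {p : X} (hp : p ∉ range j) :
    IsQuotientMap (collapse j) :=
  IsQuotientMap.of_surjective_continuous (collapse_surjective hj.injective hp)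
    (continuous_collapse hj)

theorem nonempty_homotopyEquiv_onePoint [CompactSpace X] [T2Space X] [T2Space U]
    [WeaklyLocallyCompactSpace U] {j : U → X} (hj : IsOpenEmbedding j) {p : X} (hp : p ∉ range j)
    (H : C(unitInterval × X, X)) (H0 : ∀ x, H (0, x) = x)
    (Hj : ∀ t, ∀ x ∉ range j, H (t, x) ∉ range j) (H1 : ∀ x ∉ range j, H (1, x) = p) :
    Nonempty (ContinuousMap.HomotopyEquiv X (OnePoint U)) := by
  let q : C(X, OnePoint U) := ⟨collapse j, continuous_collapse hj⟩
  have hq : IsQuotientMap q := isQuotientMap_collapse hj hp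
  have hqeq {x y : X} : q x = q y ↔ x = y ∨ x ∉ range j ∧ y ∉ range j :=
    collapse_eq_iff hj.injective
  let H₁ : C(X, X) := H.comp ⟨fun x ↦ (1, x), by fun_prop⟩
  have hH₁ : Function.FactorsThrough H₁ q := fun x y hxy ↦ by
    rcases hqeq.1 hxy with rfl | ⟨hx, hy⟩
    · rfl
    · exact (H1 x hx).trans (H1 y hy).symm
  let ψ : C(OnePoint U, X) := hq.lift H₁ hH₁
  have hψ : ψ.comp q = H₁ := hq.lift_comp _ _
  let Q : C(unitInterval × X, unitInterval × OnePoint U) :=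
    ⟨Prod.map id q, continuous_id.prodMap q.continuous⟩
  have hQ : IsQuotientMap Q := IsQuotientMap.of_surjective_continuous
    (Function.surjective_id.prodMap hq.surjective) Q.continuous
  have hqH : Function.FactorsThrough (q.comp H) Q := by
    rintro ⟨t, x⟩ ⟨t', y⟩ hxy
    obtain ⟨rfl, h⟩ : t = t' ∧ q x = q y := Prod.ext_iff.1 hxy
    refine hqeq.2 ?_
    rcases hqeq.1 h with rfl | ⟨hx, hy⟩
    · exact Or.inl rfl
    · exact Or.inr ⟨Hj t x hx, Hj t y hy⟩
  let L : C(unitInterval × OnePoint U, OnePoint U) := hQ.lift (q.comp H) hqH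
  have hL (t : unitInterval) (x : X) : L (t, q x) = q (H (t, x)) :=
    DFunLike.congr_fun (hQ.lift_comp (q.comp H) hqH) (t, x)
  refine ⟨⟨q, ψ, ContinuousMap.Homotopic.symm ⟨⟨H, H0, fun x ↦ ?_⟩⟩,
    ContinuousMap.Homotopic.symm ⟨⟨L, fun z ↦ ?_, fun z ↦ ?_⟩⟩⟩⟩
  · exact (DFunLike.congr_fun hψ x).symm
  · obtain ⟨x, rfl⟩ := hq.surjective z
    exact (hL 0 x).trans (congrArg q (H0 x))
  · obtain ⟨x, rfl⟩ := hq.surjective z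
    exact (hL 1 x).trans (congrArg q (DFunLike.congr_fun hψ x).symm)

end Collapse

section OpenFacets
open Set OnePoint Topology

variable {V : Type} [Fintype V]

lemma continuous_extend {Z V W : Type} [TopologicalSpace Z] {e : V → W}
    (he : Function.Injective e) {f : Z → V → ℝ} (hf : Continuous f) :
    Continuous fun z ↦ Function.extend e (f z) 0 := by
  refine continuous_pi fun u ↦ ?_
  by_cases hu : ∃ v, e v = u
  · obtain ⟨v, rfl⟩ := hu
    simpa only [he.extend_apply] using (by fun_prop : Continuous fun z ↦ f z v)
  · simpa only [Function.extend_apply' _ _ _ hu] using continuous_const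

/-- The interior of a maximal simplex is an open cell. -/
lemma exists_isOpenEmbedding_range_eq {K : Set (Set V)} {σ : Set V} {d : ℕ} (hσ : σ ∈ K)
    (hmax : ∀ τ ∈ K, σ ⊆ τ → σ = τ) (hcard : σ.ncard = d + 1) :
    ∃ g : EuclideanSpace ℝ (Fin d) → geomReal K, IsOpenEmbedding g ∧
      range g = {w | Function.support w.1 = σ} := by
  have : Finite σ := toFinite σ
  obtain ⟨ε⟩ : Nonempty (Fin (d + 1) ≃ σ) := ⟨(Finite.equivFinOfCardEq hcard).symm⟩
  let η : Fin (d + 1) → V := fun i ↦ ε i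
  have hη : Function.Injective η := Subtype.val_injective.comp ε.injective
  have hησ (v : V) : v ∈ σ ↔ ∃ i, η i = v :=
    ⟨fun hv ↦ ⟨ε.symm ⟨v, hv⟩, by simp [η]⟩, fun ⟨i, hi⟩ ↦ hi ▸ (ε i).2⟩
  let a : EuclideanSpace ℝ (Fin d) → Fin (d + 1) → ℝ :=
    fun x ↦ Fin.cons 1 fun k ↦ Real.exp (x k)
  have ha (x) (i) : 0 < a x i := by
    induction i using Fin.cases with
    | zero => exact one_pos
    | succ k => exact Real.exp_pos _
  have hac : Continuous a := continuous_pi fun i ↦ by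
    induction i using Fin.cases with
    | zero => exact continuous_const
    | succ k =>
      change Continuous fun x : EuclideanSpace ℝ (Fin d) ↦ Real.exp (x k)
      fun_prop
  have hS (x) : 0 < ∑ i, a x i := Finset.sum_pos (fun i _ ↦ ha x i) Finset.univ_nonempty
  let g₀ : EuclideanSpace ℝ (Fin d) → V → ℝ :=
    fun x ↦ Function.extend η (fun i ↦ a x i / ∑ k, a x k) 0
  have hg₀η (x) (i) : g₀ x (η i) = a x i / ∑ k, a x k := hη.extend_apply _ _ _
  have hg₀n (x) {v : V} (hv : v ∉ σ) : g₀ x v = 0 :=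
    Function.extend_apply' _ _ _ (mt (hησ v).2 hv)
  have hg₀c : Continuous g₀ := continuous_extend hη (continuous_pi fun i ↦
    Continuous.div (by fun_prop) (by fun_prop) fun x ↦ (hS x).ne')
  have hsupp (x) : Function.support (g₀ x) = σ := by
    ext v
    by_cases hv : v ∈ σ
    · obtain ⟨i, rfl⟩ := (hησ v).1 hv
      simp only [Function.mem_support, hg₀η, hv, iff_true]
      exact (div_pos (ha x i) (hS x)).ne'
    · simp [hg₀n x hv, hv]
  have hsum (w : V → ℝ) (hw : ∀ v ∉ σ, w v = 0) : ∑ i, w (η i) = ∑ v, w v :=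
    Fintype.sum_of_injective η hη _ _ (fun v hv ↦ hw v fun h ↦ hv ((hησ v).1 h)) fun _ ↦ rfl
  have hmem (x) : g₀ x ∈ geomReal K := by
    refine ⟨⟨fun v ↦ ?_, ?_⟩, by rw [hsupp]; exact hσ⟩
    · by_cases hv : v ∈ σ
      · obtain ⟨i, rfl⟩ := (hησ v).1 hv
        rw [hg₀η]
        exact (div_pos (ha x i) (hS x)).le
      · rw [hg₀n x hv]
    · rw [← hsum _ fun v ↦ hg₀n x]
      simp only [hg₀η]
      rw [← Finset.sum_div, div_self (hS x).ne']
  let g : EuclideanSpace ℝ (Fin d) → geomReal K := fun x ↦ ⟨g₀ x, hmem x⟩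
  have hgc : Continuous g := hg₀c.subtype_mk _
  let f : geomReal K → EuclideanSpace ℝ (Fin d) :=
    fun w ↦ WithLp.toLp 2 fun k ↦ Real.log (w.1 (η k.succ) / w.1 (η 0))
  have hfg (x) : f (g x) = x := by
    ext k
    simp only [f, g, hg₀η]
    rw [div_div_div_cancel_right₀ (hS x).ne']
    simp [a]
  have hpos {w : geomReal K} (hw : Function.support w.1 = σ) (i) : 0 < w.1 (η i) :=
    lt_of_le_of_ne (w.2.1.1 _) (Ne.symm (hw.ge ((hησ _).2 ⟨i, rfl⟩)))
  have hgf (w : geomReal K) (hw : Function.support w.1 = σ) : g (f w) = w := by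
    have haf (i) : a (f w) i = w.1 (η i) / w.1 (η 0) := by
      induction i using Fin.cases with
      | zero => exact (div_self (hpos hw 0).ne').symm
      | succ k => exact Real.exp_log (div_pos (hpos hw _) (hpos hw 0))
    have hw0 : ∀ v ∉ σ, w.1 v = 0 := fun v hv ↦ by
      by_contra h
      exact hv (hw.le h)
    refine Subtype.ext (funext fun v ↦ ?_)
    change g₀ (f w) v = w.1 v
    by_cases hv : v ∈ σ
    · obtain ⟨i, rfl⟩ := (hησ v).1 hv
      rw [hg₀η]
      simp only [haf]
      rw [← Finset.sum_div, hsum _ hw0, w.2.1.2, div_div_div_cancel_right₀ (hpos hw 0).ne',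
        div_one]
    · rw [hg₀n _ hv, hw0 v hv]
  have hcoord (v : V) : Continuous fun w : geomReal K ↦ w.1 v :=
    (continuous_apply v).comp continuous_subtype_val
  have hrange : range g = {w | Function.support w.1 = σ} :=
    subset_antisymm (range_subset_iff.2 hsupp) fun w hw ↦ ⟨f w, hgf w hw⟩
  have hopen : IsOpen {w : geomReal K | Function.support w.1 = σ} := by
    have : {w : geomReal K | Function.support w.1 = σ} = ⋂ i, {w | 0 < w.1 (η i)} := by
      ext w
      refine ⟨fun hw ↦ mem_iInter.2 fun i ↦ hpos hw i, fun hw ↦ ?_⟩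
      refine (hmax _ w.2.2 fun v hv ↦ ?_).symm
      obtain ⟨i, rfl⟩ := (hησ v).1 hv
      exact (mem_iInter.1 hw i).ne'
    rw [this]
    exact isOpen_iInter_of_finite fun i ↦ isOpen_lt continuous_const (hcoord _)
  have hfc : ContinuousOn f {w | Function.support w.1 = σ} := by
    refine (PiLp.continuous_toLp 2 _).comp_continuousOn (continuousOn_pi.2 fun k ↦ ?_)
    refine ContinuousOn.log (ContinuousOn.div
      (hcoord _).continuousOn (hcoord _).continuousOn fun w hw ↦
      (hpos hw 0).ne') fun w hw ↦ (div_pos (hpos hw _) (hpos hw 0)).ne'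
  refine ⟨g, .of_continuous_injective_isOpenMap hgc (Function.LeftInverse.injective hfg)
    fun s hs ↦ ?_, hrange⟩
  convert hfc.isOpen_inter_preimage hopen hs using 1
  ext w
  constructor
  · rintro ⟨x, hx, rfl⟩
    exact ⟨hsupp x, by rwa [mem_preimage, hfg]⟩
  · rintro ⟨hw, hws⟩
    exact ⟨f w, hws, hgf w hw⟩

instance Sigma.weaklyLocallyCompactSpace {ι : Type} {X : ι → Type} [∀ i, TopologicalSpace (X i)]
    [∀ i, WeaklyLocallyCompactSpace (X i)] : WeaklyLocallyCompactSpace (Σ i, X i) where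
  exists_compact_mem_nhds := fun ⟨i, x⟩ ↦ by
    obtain ⟨C, hC, hx⟩ := exists_compact_mem_nhds x
    exact ⟨Sigma.mk i '' C, hC.image continuous_sigmaMk,
      IsOpenEmbedding.sigmaMk.image_mem_nhds.2 hx⟩

theorem nonempty_homotopyEquiv_of_isAbsExtensor {K : Set (Set V)} (hK : IsLowerSet K) {ι : Type}
    [Finite ι] {F : ι → Set V} (hinj : Function.Injective F)
    (hmax : ∀ i, F i ∈ K ∧ ∀ σ ∈ K, F i ⊆ σ → F i = σ) {d : ℕ}
    (hcard : ∀ i, (F i).ncard = d + 1) (hAE : IsAbsExtensor (geomReal (K \ range F))) :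
    Nonempty (ContinuousMap.HomotopyEquiv (geomReal K)
      (OnePoint (Σ _ : ι, EuclideanSpace ℝ (Fin d)))) := by
  choose g hg hgr using fun i ↦ exists_isOpenEmbedding_range_eq (hmax i).1 (hmax i).2 (hcard i)
  let j : (Σ _ : ι, EuclideanSpace ℝ (Fin d)) → geomReal K := fun u ↦ g u.1 u.2
  have hgs (i x) : Function.support (g i x).1 = F i := (hgr i).le ⟨x, rfl⟩
  have hj : IsOpenEmbedding j := by
    refine .of_continuous_injective_isOpenMap (continuous_sigma fun i ↦ (hg i).continuous) ?_
      (isOpenMap_sigma.2 fun i ↦ (hg i).isOpenMap)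
    rintro ⟨i, x⟩ ⟨i', x'⟩ h
    obtain rfl : i = i' := hinj (by rw [← hgs i x, ← hgs i' x']; exact congrArg _ (congrArg _ h))
    exact congrArg (Sigma.mk i) ((hg i).injective h)
  have hjr (w : geomReal K) : w ∉ range j ↔ w.1 ∈ geomReal (K \ range F) := by
    rw [← not_iff_not, not_not]
    constructor
    · rintro ⟨⟨i, x⟩, rfl⟩ h
      exact h.2.2 ⟨i, (hgs i x).symm⟩
    · intro h
      obtain ⟨i, hi⟩ : Function.support w.1 ∈ range F := by
        by_contra h'
        exact h ⟨w.2.1, w.2.2, h'⟩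
      obtain ⟨x, hx⟩ := (hgr i).ge hi.symm
      exact ⟨⟨i, x⟩, hx⟩
  have : CompactSpace (geomReal K) := isCompact_iff_compactSpace.1
    ((isCompact_stdSimplex ℝ V).of_isClosed_subset (isClosed_geomReal hK) fun w hw ↦ hw.1)
  obtain ⟨H, hHc, hHK, hHK', hH0, p, hp, hH1⟩ :=
    exists_homotopy_of_isAbsExtensor hK hinj hmax hAE
  let H' : C(unitInterval × geomReal K, geomReal K) :=
    ⟨fun z ↦ ⟨H (z.2.1, z.1.1), hHK ⟨z.2.2, z.1.2⟩⟩, Continuous.subtype_mk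
      (hHc.comp_continuous (by fun_prop) fun z ↦ ⟨z.2.2, z.1.2⟩) _⟩
  refine nonempty_homotopyEquiv_onePoint hj (p := ⟨p, hp.1, hp.2.1⟩) ((hjr _).2 hp) H'
    (fun w ↦ Subtype.ext (hH0 w w.2)) (fun t w hw ↦ (hjr _).2 (hHK' ⟨(hjr _).1 hw, t.2⟩))
    fun w hw ↦ Subtype.ext (hH1 w ((hjr _).1 hw))

end OpenFacets

section Wedge
open Set OnePoint Topology

/-- Each sphere minus the base point, as an open subset of the disjoint union of the spheres and
the extra base point. -/
lemma exists_isOpenEmbedding_wedge (k d : ℕ) :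
    ∃ j : (Σ _ : Fin k, EuclideanSpace ℝ (Fin d)) →
      (Σ _ : Fin k, Metric.sphere (0 : EuclideanSpace ℝ (Fin (d + 1))) 1) ⊕ Unit,
      IsOpenEmbedding j ∧ (∀ x, .inr x ∉ range j) ∧
      ∀ p, .inl p ∉ range j ↔
        (p.2 : EuclideanSpace ℝ (Fin (d + 1))) = EuclideanSpace.single 0 1 := by
  have : Fact (Module.finrank ℝ (EuclideanSpace ℝ (Fin (d + 1))) = d + 1) := ⟨by simp⟩
  let v : Metric.sphere (0 : EuclideanSpace ℝ (Fin (d + 1))) 1 :=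
    ⟨EuclideanSpace.single 0 1, by simp⟩
  let s := (stereographic' d v).symm
  have hs : IsOpenEmbedding s := s.isOpenEmbedding (by simp [s])
  have hsr : range s = {v}ᶜ := by
    simpa [s] using s.image_source_eq_target
  refine ⟨fun u ↦ .inl ⟨u.1, s u.2⟩, ?_, by simp, fun p ↦ ?_⟩
  · refine IsOpenEmbedding.inl.comp (.of_continuous_injective_isOpenMap
      (continuous_sigma fun i ↦ continuous_sigmaMk.comp hs.continuous) ?_
      (isOpenMap_sigma.2 fun i ↦ isOpenMap_sigmaMk.comp hs.isOpenMap))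
    rintro ⟨i, x⟩ ⟨i', x'⟩ h
    simp only [Sigma.mk.injEq, heq_eq_eq] at h
    obtain ⟨rfl, h⟩ := h
    rw [hs.injective h]
  · have : p.2 ∈ range s ↔ p.2 ≠ v := by rw [hsr]; rfl
    rw [← show p.2 = v ↔ _ from Subtype.ext_iff, ← not_iff_not, not_not, ← ne_eq, ← this]
    constructor
    · rintro ⟨u, hu⟩
      rw [← Sum.inl.inj hu]
      exact ⟨_, rfl⟩
    · rintro ⟨x, hx⟩
      exact ⟨⟨p.1, x⟩, by simp [hx]⟩

lemma nonempty_homeomorph_wedgeOfSpheres (k d : ℕ) :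
    Nonempty (WedgeOfSpheres k d ≃ₜ OnePoint (Σ _ : Fin k, EuclideanSpace ℝ (Fin d))) := by
  obtain ⟨j, hj, hr, hl⟩ := exists_isOpenEmbedding_wedge k d
  have hcl {a b} : collapse j a = collapse j b ↔ _ := collapse_eq_iff hj.injective
  let f : WedgeOfSpheres k d → OnePoint (Σ _ : Fin k, EuclideanSpace ℝ (Fin d)) :=
    Quot.lift (collapse j) fun a b h ↦ hcl.2 <| h.imp id fun h ↦ by
      rcases a with a | a <;> rcases b with b | b
      exacts [⟨(hl a).2 h.1, (hl b).2 h.2⟩, ⟨(hl a).2 h.1, hr b⟩, ⟨hr a, (hl b).2 h.2⟩,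
        ⟨hr a, hr b⟩]
  have hf : Continuous f := continuous_quot_lift _ (continuous_collapse hj)
  have hbij : Function.Bijective f := by
    refine ⟨?_, fun z ↦ ?_⟩
    · rintro ⟨a⟩ ⟨b⟩ hab
      refine Quot.sound ((hcl.1 hab).imp id fun h ↦ ?_)
      rcases a with a | a <;> rcases b with b | b
      exacts [⟨(hl a).1 h.1, (hl b).1 h.2⟩, ⟨(hl a).1 h.1, trivial⟩, ⟨trivial, (hl b).1 h.2⟩,
        ⟨trivial, trivial⟩]
    · obtain ⟨a, rfl⟩ := collapse_surjective hj.injective (hr ()) z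
      exact ⟨Quot.mk _ a, rfl⟩
  have : CompactSpace (WedgeOfSpheres k d) := Quot.compactSpace
  exact ⟨hf.homeoOfEquivCompactToT2 (f := Equiv.ofBijective f hbij)⟩

end Wedge

/-- The geometric realization `|Π_n|` of the nerve of the poset of
proper nontrivial partitions of `{1,…,n}` is homotopy equivalent (non-equivariantly) to
a wedge of `(n−1)!` spheres of dimension `n−3`. -/
theorem partitionComplex_homotopyEquiv_wedge_of_spheres (n : ℕ) (hn : 3 ≤ n) :
    Nonempty (ContinuousMap.HomotopyEquiv
      (PartitionComplex n) (WedgeOfSpheres ((n - 1).factorial) (n - 3))) := by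
  obtain ⟨m, rfl⟩ := Nat.exists_eq_add_of_le' hn
  have : Finite (PartitionPoset (m + 3)) := inferInstanceAs (Finite (ProperSetoid (Fin (m + 3))))
  let hfin : Fintype (PartitionPoset (m + 3)) := Fintype.ofFinite _
  have hsph : HasSphericalChains (PartitionPoset (m + 3)) (m + 1) (m + 2).factorial :=
    @hasSphericalChains_properSetoid (m + 1) (Fin (m + 3)) inferInstance hfin (by simp)
  obtain ⟨ι, _, F, hcard, hinj, hmax, hAE⟩ := hsph
  replace hAE : IsAbsExtensor (geomReal (chainFaces (PartitionPoset (m + 3)) \ Set.range F)) := by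
    refine hAE.resolve_left fun h0 ↦ ?_
    obtain ⟨i, hi⟩ : ∅ ∈ Set.range F := by
      by_contra h
      exact h0.le ⟨IsChain.empty, h⟩
    have := (hmax i).2
    rw [hi, Set.ncard_empty] at this
    omega
  let e : Fin (m + 2).factorial ≃ ι := (Finite.equivFinOfCardEq hcard).symm
  obtain ⟨h₁⟩ := nonempty_homotopyEquiv_of_isAbsExtensor
    (K := chainFaces (PartitionPoset (m + 3))) (F := F ∘ e) (d := m)
    (fun _ _ h hc ↦ IsChain.mono h hc) (hinj.comp e.injective)
    (fun i ↦ ⟨(hmax (e i)).1.1, fun _ hσ h ↦ (hmax (e i)).1.2 hσ h⟩)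
    (fun i ↦ (hmax (e i)).2) (by rwa [e.surjective.range_comp])
  obtain ⟨h₂⟩ := nonempty_homeomorph_wedgeOfSpheres (m + 2).factorial m
  exact ⟨((GeometricRealization.nerveHomeo (PartitionPoset (m + 3))).toHomotopyEquiv.trans
    h₁).trans h₂.symm.toHomotopyEquiv⟩
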